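/- arXiv:1609.07315 — 2 statements merged into one kernel-verified Lean document; each statement's English description precedes it below -/
import Mathlib

section
/- Let μ_{k,n−k} be the uniform probability measure on the slice X_{k,n−k} of the discrete cube. Then for all probability measures ν₁, ν₂ on X_{k,n−k}, T̂₂(ν₂|ν₁) ≤ 8 · ( √H(ν₁|μ_{k,n−k}) + √H(ν₂|μ_{k,n−k}) )². -/
attribute [local instance] Classical.propDecidable

noncomputable section

/-- The cubeSlice `X_{k, n-k}` of the discrete cube `{0,1}^n`. -/
def cubeSlice (n k : ℕ) : Set (Fin n → Bool) :=
  {x | (Finset.univ.filter fun i => x i = true).card = k}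

/-- The uniform probability measure on the cubeSlice `X_{k, n-k}`. -/
noncomputable def unifSlice (n k : ℕ) : (Fin n → Bool) → ℝ :=
  fun x => if x ∈ cubeSlice n k then ((n.choose k : ℝ))⁻¹ else 0

/-- Relative entropy `H(ν | μ)` of finitely supported densities; `+∞` if `ν` is not
absolutely continuous with respect to `μ`. -/
noncomputable def relEnt {X : Type*} [Fintype X] (ν μ : X → ℝ) : ENNReal :=
  if ∀ x, μ x = 0 → ν x = 0 then
    ENNReal.ofReal (∑ x, ν x * Real.log (ν x / μ x))
  else ⊤

/-- `p` is a probability measure supported on the set `S`. -/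
def IsProbOn {X : Type*} [Fintype X] (p : X → ℝ) (S : Set X) : Prop :=
  (∀ x, 0 ≤ p x) ∧ (∀ x, x ∉ S → p x = 0) ∧ ∑ x, p x = 1

/-- The weak transport cost `T̂₂(ν₂ | ν₁)` on the discrete cube
(kernel formulation, `π(x, y) = ν₁(x) p_x(y)`). -/
noncomputable def hatT2 {n : ℕ} (ν₁ ν₂ : (Fin n → Bool) → ℝ) : ℝ :=
  sInf {w | ∃ p : (Fin n → Bool) → (Fin n → Bool) → ℝ,
    (∀ x y, 0 ≤ p x y) ∧ (∀ x, ∑ y, p x y = 1) ∧ (∀ y, ∑ x, ν₁ x * p x y = ν₂ y) ∧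
    w = ∑ x, ν₁ x * ∑ i : Fin n,
      (∑ y, p x y * (if x i ≠ y i then (1 : ℝ) else 0)) ^ 2}

namespace SliceTransport

open Finset

variable {n : ℕ}

/-- The configurations which agree with `x` outside `F` and have as many ones as `x`. -/
def freeSlice (F : Finset (Fin n)) (x : Fin n → Bool) : Finset (Fin n → Bool) :=
  univ.filter fun y => (∀ j, j ∉ F → y j = x j) ∧
    (univ.filter fun i => y i = true).card = (univ.filter fun i => x i = true).card

/-- The average of `ν` over the free slice through each point. -/
def sliceAvg (F : Finset (Fin n)) (ν : (Fin n → Bool) → ℝ) (x : Fin n → Bool) : ℝ :=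
  (∑ y ∈ freeSlice F x, ν y) / (freeSlice F x).card

/-- The coordinates in `F` at which `x` takes the value `s`. -/
def level (F : Finset (Fin n)) (s : Bool) (x : Fin n → Bool) : Finset (Fin n) :=
  F.filter fun j => x j = s

/-- The configuration `x` with the values at `i` and `j` exchanged. -/
def exch (i j : Fin n) (x : Fin n → Bool) : Fin n → Bool := fun l => x (Equiv.swap i j l)

lemma mem_freeSlice {F : Finset (Fin n)} {x y : Fin n → Bool} :
    y ∈ freeSlice F x ↔ (∀ j, j ∉ F → y j = x j) ∧
      (univ.filter fun i => y i = true).card = (univ.filter fun i => x i = true).card := by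
  simp [freeSlice]

lemma self_mem_freeSlice (F : Finset (Fin n)) (x : Fin n → Bool) : x ∈ freeSlice F x := by
  simp [mem_freeSlice]

lemma freeSlice_card_pos (F : Finset (Fin n)) (x : Fin n → Bool) :
    (0 : ℝ) < (freeSlice F x).card := by
  exact_mod_cast card_pos.2 ⟨x, self_mem_freeSlice F x⟩

lemma freeSlice_symm {F : Finset (Fin n)} {x y : Fin n → Bool} :
    y ∈ freeSlice F x ↔ x ∈ freeSlice F y := by
  simp only [mem_freeSlice, eq_comm]

lemma freeSlice_congr {F : Finset (Fin n)} {x y : Fin n → Bool} (h : y ∈ freeSlice F x) :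
    freeSlice F y = freeSlice F x := by
  rw [mem_freeSlice] at h
  ext z
  rw [mem_freeSlice, mem_freeSlice, h.2]
  refine and_congr_left fun _ => forall₂_congr fun j hj => ?_
  rw [h.1 j hj]

lemma sliceAvg_congr {F : Finset (Fin n)} (ν : (Fin n → Bool) → ℝ) {x y : Fin n → Bool}
    (h : y ∈ freeSlice F x) : sliceAvg F ν y = sliceAvg F ν x := by
  rw [sliceAvg, sliceAvg, freeSlice_congr h]

lemma sliceAvg_nonneg (F : Finset (Fin n)) {ν : (Fin n → Bool) → ℝ} (hν : ∀ x, 0 ≤ ν x)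
    (x : Fin n → Bool) : 0 ≤ sliceAvg F ν x :=
  div_nonneg (sum_nonneg fun y _ => hν y) (Nat.cast_nonneg _)

lemma card_mul_sliceAvg (F : Finset (Fin n)) (ν : (Fin n → Bool) → ℝ) (x : Fin n → Bool) :
    (freeSlice F x).card * sliceAvg F ν x = ∑ y ∈ freeSlice F x, ν y := by
  rw [sliceAvg, mul_div_cancel₀ _ (freeSlice_card_pos F x).ne']

lemma eq_zero_of_sliceAvg_eq_zero {F : Finset (Fin n)} {ν : (Fin n → Bool) → ℝ}
    (hν : ∀ x, 0 ≤ ν x) {x : Fin n → Bool} (h : sliceAvg F ν x = 0) : ν x = 0 := by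
  have := card_mul_sliceAvg F ν x
  rw [h, mul_zero, eq_comm, sum_eq_zero_iff_of_nonneg fun y _ => hν y] at this
  exact this x (self_mem_freeSlice F x)

lemma sum_sliceAvg_mul (F : Finset (Fin n)) (ν φ : (Fin n → Bool) → ℝ)
    (hφ : ∀ x, ∀ y ∈ freeSlice F x, φ y = φ x) :
    ∑ x, sliceAvg F ν x * φ x = ∑ x, ν x * φ x := by
  have h1 : ∀ x, sliceAvg F ν x * φ x =
      ∑ y, if y ∈ freeSlice F x then ν y * φ y / (freeSlice F y).card else 0 := by
    intro x
    rw [← sum_filter, sliceAvg, div_mul_eq_mul_div, sum_mul, sum_div]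
    simp only [filter_mem_eq_inter, univ_inter]
    refine sum_congr rfl fun y hy => ?_
    rw [hφ x y hy, freeSlice_congr hy]
  simp only [h1]
  rw [sum_comm]
  refine sum_congr rfl fun y _ => ?_
  have : ∀ x, (y ∈ freeSlice F x) ↔ x ∈ freeSlice F y := fun x => freeSlice_symm
  simp only [this]
  rw [← sum_filter]
  simp only [filter_mem_eq_inter, univ_inter, sum_const, nsmul_eq_mul]
  rw [mul_div_cancel₀ _ (freeSlice_card_pos F y).ne']

lemma sum_sliceAvg (F : Finset (Fin n)) (ν : (Fin n → Bool) → ℝ) :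
    ∑ x, sliceAvg F ν x = ∑ x, ν x := by
  simpa using sum_sliceAvg_mul F ν (fun _ => 1) (fun _ _ _ => rfl)

lemma sum_le_sum_of_freeSlice (F : Finset (Fin n)) (φ ψ : (Fin n → Bool) → ℝ)
    (h : ∀ x, ∑ y ∈ freeSlice F x, φ y ≤ ∑ y ∈ freeSlice F x, ψ y) :
    ∑ x, φ x ≤ ∑ x, ψ x := by
  rw [← sum_sliceAvg F φ, ← sum_sliceAvg F ψ]
  exact sum_le_sum fun x _ => div_le_div_of_nonneg_right (h x) (Nat.cast_nonneg _)

lemma mem_freeSlice_erase {F : Finset (Fin n)} {i : Fin n} {x y : Fin n → Bool}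
    (hi : i ∈ F) :
    y ∈ freeSlice (F.erase i) x ↔ y ∈ freeSlice F x ∧ y i = x i := by
  simp only [mem_freeSlice, mem_erase, not_and_or, not_not]
  constructor
  · rintro ⟨h, h'⟩
    exact ⟨⟨fun j hj => h j (Or.inr hj), h'⟩, h i (Or.inl rfl)⟩
  · rintro ⟨⟨h, h'⟩, hx⟩
    refine ⟨fun j hj => ?_, h'⟩
    rcases hj with rfl | hj
    · exact hx
    · exact h j hj

lemma card_level_true_congr {F : Finset (Fin n)} {x y : Fin n → Bool}
    (h : y ∈ freeSlice F x) : (level F true y).card = (level F true x).card := by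
  rw [mem_freeSlice] at h
  have key : ∀ z : Fin n → Bool, (univ.filter fun i => z i = true).card =
      (level F true z).card + ((univ \ F).filter fun i => z i = true).card := by
    intro z
    rw [level, ← card_union_of_disjoint, ← filter_union, union_sdiff_of_subset (subset_univ F)]
    exact disjoint_filter_filter disjoint_sdiff
  have h2 : ((univ \ F).filter fun i => y i = true) = ((univ \ F).filter fun i => x i = true) :=
    filter_congr fun j hj => by rw [h.1 j (by simpa using hj)]
  have := h.2
  rw [key x, key y, h2] at this
  omega

lemma card_level_add (F : Finset (Fin n)) (s : Bool) (x : Fin n → Bool) :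
    (level F s x).card + (level F (!s) x).card = F.card := by
  rw [level, level, ← card_union_of_disjoint, ← filter_or]
  · congr 1
    refine filter_true_of_mem fun j _ => ?_
    cases x j <;> cases s <;> simp
  · refine disjoint_filter.2 fun j _ h => ?_
    rw [h]; cases s <;> simp

lemma card_level_congr {F : Finset (Fin n)} {x y : Fin n → Bool} (s : Bool)
    (h : y ∈ freeSlice F x) : (level F s y).card = (level F s x).card := by
  have h1 := card_level_true_congr h
  cases s
  · have h2 := card_level_add F true x
    have h3 := card_level_add F true y
    simp only [Bool.not_true] at h2 h3
    omega
  · exact h1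

@[simp] lemma exch_exch (i j : Fin n) (x : Fin n → Bool) : exch i j (exch i j x) = x := by
  funext l; simp [exch]

@[simp] lemma exch_left (i j : Fin n) (x : Fin n → Bool) : exch i j x i = x j := by
  simp [exch]

@[simp] lemma exch_right (i j : Fin n) (x : Fin n → Bool) : exch i j x j = x i := by
  simp [exch]

lemma exch_of_ne {i j l : Fin n} (x : Fin n → Bool) (h1 : l ≠ i) (h2 : l ≠ j) :
    exch i j x l = x l := by
  simp [exch, Equiv.swap_apply_of_ne_of_ne h1 h2]

/-- Exchanging two coordinates, as a permutation of the cube. -/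
def exchEquiv (i j : Fin n) : (Fin n → Bool) ≃ (Fin n → Bool) where
  toFun := exch i j
  invFun := exch i j
  left_inv := exch_exch i j
  right_inv := exch_exch i j

lemma exch_mem_freeSlice {F : Finset (Fin n)} {i j : Fin n} (hi : i ∈ F) (hj : j ∈ F)
    (x : Fin n → Bool) : exch i j x ∈ freeSlice F x := by
  rw [mem_freeSlice]
  constructor
  · intro l hl
    exact exch_of_ne x (fun h => hl (h ▸ hi)) (fun h => hl (h ▸ hj))
  · refine card_bij (fun l _ => Equiv.swap i j l) ?_ ?_ ?_
    · intro l hl; rw [mem_filter] at hl ⊢; simpa [exch] using hl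
    · intro a _ b _ h; exact (Equiv.swap i j).injective h
    · intro b hb
      refine ⟨Equiv.swap i j b, ?_, by simp⟩
      rw [mem_filter] at hb ⊢; simpa [exch] using hb

lemma card_filter_freeSlice {F : Finset (Fin n)} {i : Fin n} (hi : i ∈ F) (s : Bool)
    (x : Fin n → Bool) :
    F.card * ((freeSlice F x).filter fun y => y i = s).card =
      (freeSlice F x).card * (level F s x).card := by
  have h1 : ∀ j ∈ F, ((freeSlice F x).filter fun y => y j = s).card =
      ((freeSlice F x).filter fun y => y i = s).card := by
    intro j hj
    refine card_bij (fun y _ => exch i j y) ?_ ?_ ?_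
    · intro y hy
      rw [mem_filter] at hy ⊢
      refine ⟨?_, by simpa using hy.2⟩
      rw [← freeSlice_congr hy.1]
      exact exch_mem_freeSlice hi hj y
    · intro a _ b _ h; exact (exchEquiv i j).injective h
    · intro y hy
      rw [mem_filter] at hy
      refine ⟨exch i j y, ?_, by simp⟩
      rw [mem_filter]
      refine ⟨?_, by simpa using hy.2⟩
      rw [← freeSlice_congr hy.1]
      exact exch_mem_freeSlice hi hj y
  have h2 : ∑ j ∈ F, ((freeSlice F x).filter fun y => y j = s).card =
      ∑ y ∈ freeSlice F x, (level F s y).card := by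
    simp only [level, card_filter]
    exact sum_comm
  rw [sum_congr rfl h1, sum_const, smul_eq_mul,
    sum_congr rfl fun y hy => card_level_congr s hy, sum_const, smul_eq_mul] at h2
  exact h2

lemma filter_freeSlice_self {F : Finset (Fin n)} {i : Fin n} (hi : i ∈ F)
    (x : Fin n → Bool) :
    ((freeSlice F x).filter fun y => y i = x i) = freeSlice (F.erase i) x := by
  ext y; rw [mem_filter, mem_freeSlice_erase hi]

lemma card_freeSlice_erase {F : Finset (Fin n)} {i : Fin n} (hi : i ∈ F) (x : Fin n → Bool) :
    (F.card : ℝ) * (freeSlice (F.erase i) x).card =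
      (freeSlice F x).card * (level F (x i) x).card := by
  rw [← filter_freeSlice_self hi]
  exact_mod_cast card_filter_freeSlice hi (x i) x

/-- The coordinates in `F` at which `x` differs from its value at `i`. -/
def opp (F : Finset (Fin n)) (i : Fin n) (x : Fin n → Bool) : Finset (Fin n) :=
  level F (!x i) x

lemma mem_opp {F : Finset (Fin n)} {i j : Fin n} {x : Fin n → Bool} :
    j ∈ opp F i x ↔ j ∈ F ∧ x j = !x i := by
  rw [opp, level, mem_filter]

lemma mem_opp_comm {F : Finset (Fin n)} {i j : Fin n} {x : Fin n → Bool} (hi : i ∈ F)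
    (hj : j ∈ F) : j ∈ opp F i x ↔ i ∈ opp F j x := by
  rw [mem_opp, mem_opp]
  simp only [hi, hj, true_and]
  cases x i <;> cases x j <;> simp

lemma mem_opp_exch {F : Finset (Fin n)} {i j : Fin n} {x : Fin n → Bool} :
    j ∈ opp F i (exch i j x) ↔ j ∈ opp F i x := by
  rw [mem_opp, mem_opp, exch_left, exch_right]
  cases x i <;> cases x j <;> simp

lemma card_level_add_opp (F : Finset (Fin n)) (i : Fin n) (x : Fin n → Bool) :
    ((level F (x i) x).card : ℝ) + (opp F i x).card = F.card := by
  exact_mod_cast card_level_add F (x i) x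

lemma card_level_pos {F : Finset (Fin n)} {i : Fin n} (hi : i ∈ F) (x : Fin n → Bool) :
    (0 : ℝ) < (level F (x i) x).card := by
  exact_mod_cast card_pos.2 ⟨i, by simp [level, hi]⟩

lemma card_opp_exch {F : Finset (Fin n)} {i j : Fin n} {x : Fin n → Bool} (hi : i ∈ F)
    (hj : j ∈ opp F i x) : (opp F i (exch i j x)).card = (level F (x i) x).card := by
  rw [mem_opp] at hj
  rw [opp, card_level_congr _ (exch_mem_freeSlice hi hj.1 x), exch_left, hj.2, Bool.not_not]

lemma card_level_exch {F : Finset (Fin n)} {i j : Fin n} {x : Fin n → Bool} (hi : i ∈ F)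
    (hj : j ∈ opp F i x) :
    (level F (exch i j x i) (exch i j x)).card = (opp F i x).card := by
  rw [mem_opp] at hj
  rw [opp, card_level_congr _ (exch_mem_freeSlice hi hj.1 x), exch_left, hj.2]

lemma sum_sum_opp (F : Finset (Fin n)) (i : Fin n) (Ψ : (Fin n → Bool) → Fin n → ℝ) :
    ∑ x, ∑ j ∈ opp F i x, Ψ x j = ∑ x, ∑ j ∈ opp F i x, Ψ (exch i j x) j := by
  have h : ∀ Φ : (Fin n → Bool) → Fin n → ℝ, ∑ x, ∑ j ∈ opp F i x, Φ x j =
      ∑ j, ∑ x, if j ∈ opp F i x then Φ x j else 0 := by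
    intro Φ
    rw [sum_comm]
    exact sum_congr rfl fun x _ => by rw [← sum_filter]; simp
  rw [h, h]
  refine sum_congr rfl fun j _ => ?_
  rw [← (exchEquiv i j).sum_comp]
  refine sum_congr rfl fun x _ => ?_
  change (if j ∈ opp F i (exch i j x) then Ψ (exch i j x) j else 0) = _
  simp only [mem_opp_exch]

lemma exch_mem_freeSlice_erase {F : Finset (Fin n)} {i j j' : Fin n} {x y : Fin n → Bool}
    (hi : i ∈ F) (hy : y ∈ freeSlice (F.erase i) x) (hj : j ∈ opp F i x)
    (hj' : j' ∈ opp F i y) : exch i j' y ∈ freeSlice (F.erase i) (exch i j x) := by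
  rw [mem_freeSlice_erase hi] at hy ⊢
  rw [mem_opp] at hj hj'
  refine ⟨?_, by rw [exch_left, exch_left, hj.2, hj'.2, hy.2]⟩
  rw [freeSlice_congr (exch_mem_freeSlice hi hj.1 x), ← freeSlice_congr hy.1]
  exact exch_mem_freeSlice hi hj'.1 y

lemma freeSlice_erase_eq {F : Finset (Fin n)} {i : Fin n} (hi : i ∈ F) {x : Fin n → Bool}
    (h : opp F i x = ∅) : freeSlice (F.erase i) x = freeSlice F x := by
  have hm : (0 : ℝ) < F.card := by exact_mod_cast card_pos.2 ⟨i, hi⟩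
  have h1 := card_freeSlice_erase hi x
  have h2 := card_level_add_opp F i x
  rw [h, card_empty, Nat.cast_zero, add_zero] at h2
  rw [h2, mul_comm] at h1
  have h3 := mul_right_cancel₀ hm.ne' h1
  refine eq_of_subset_of_card_le (fun y hy => ((mem_freeSlice_erase hi).1 hy).1) ?_
  exact_mod_cast h3.ge

lemma sliceAvg_erase_of_opp_eq_empty {F : Finset (Fin n)} {i : Fin n} (hi : i ∈ F)
    (ν : (Fin n → Bool) → ℝ) {x : Fin n → Bool} (h : opp F i x = ∅) :
    sliceAvg (F.erase i) ν x = sliceAvg F ν x := by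
  rw [sliceAvg, sliceAvg, freeSlice_erase_eq hi h]

lemma level_mul_sliceAvg_erase {F : Finset (Fin n)} {i j : Fin n} (hi : i ∈ F)
    (ν : (Fin n → Bool) → ℝ) {x : Fin n → Bool} (hj : j ∈ opp F i x) :
    ((level F (x i) x).card : ℝ) * (sliceAvg (F.erase i) ν x - sliceAvg F ν x) =
      (opp F i x).card * (sliceAvg F ν x - sliceAvg (F.erase i) ν (exch i j x)) := by
  have hjF := (mem_opp.1 hj).1
  have h1 := card_freeSlice_erase hi x
  have h2 := card_freeSlice_erase hi (exch i j x)
  rw [card_level_exch hi hj, freeSlice_congr (exch_mem_freeSlice hi hjF x)] at h2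
  have h3 := card_mul_sliceAvg F ν x
  rw [← sum_filter_add_sum_filter_not _ (fun y => y i = x i), filter_freeSlice_self hi] at h3
  have h4 : ((freeSlice F x).filter fun y => ¬ y i = x i) =
      freeSlice (F.erase i) (exch i j x) := by
    rw [← filter_freeSlice_self hi, freeSlice_congr (exch_mem_freeSlice hi hjF x), exch_left,
      (mem_opp.1 hj).2]
    refine filter_congr fun y _ => ?_
    cases y i <;> cases x i <;> simp
  rw [h4, ← card_mul_sliceAvg, ← card_mul_sliceAvg] at h3
  have h5 := card_level_add_opp F i x
  have hN := (freeSlice_card_pos F x).ne'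
  refine mul_left_cancel₀ hN ?_
  linear_combination (-(F.card : ℝ)) * h3 - sliceAvg (F.erase i) ν x * h1 -
    sliceAvg (F.erase i) ν (exch i j x) * h2 + (-(freeSlice F x).card * sliceAvg F ν x) * h5

lemma level_mul_posPart {F : Finset (Fin n)} {i : Fin n} (hi : i ∈ F)
    (ν : (Fin n → Bool) → ℝ) (x : Fin n → Bool) :
    ((level F (x i) x).card : ℝ) * max (sliceAvg (F.erase i) ν x - sliceAvg F ν x) 0 =
      ∑ j ∈ opp F i x, max (sliceAvg F ν x - sliceAvg (F.erase i) ν (exch i j x)) 0 := by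
  rcases (opp F i x).eq_empty_or_nonempty with h | ⟨j, hj⟩
  · rw [h, sum_empty, sliceAvg_erase_of_opp_eq_empty hi ν h]; simp
  · have : ∀ j' ∈ opp F i x, max (sliceAvg F ν x - sliceAvg (F.erase i) ν (exch i j' x)) 0 =
        max (sliceAvg F ν x - sliceAvg (F.erase i) ν (exch i j x)) 0 := fun j' hj' => by
      rw [sliceAvg_congr ν (exch_mem_freeSlice_erase hi (self_mem_freeSlice _ x) hj hj')]
    rw [sum_congr rfl this, sum_const, nsmul_eq_mul]
    rw [mul_max_of_nonneg _ _ (Nat.cast_nonneg _), mul_max_of_nonneg _ _ (Nat.cast_nonneg _),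
      level_mul_sliceAvg_erase hi ν hj, mul_zero, mul_zero]

lemma level_mul_negPart {F : Finset (Fin n)} {i : Fin n} (hi : i ∈ F)
    (ν : (Fin n → Bool) → ℝ) (x : Fin n → Bool) :
    ((level F (x i) x).card : ℝ) * max (sliceAvg F ν x - sliceAvg (F.erase i) ν x) 0 =
      ∑ j ∈ opp F i x, max (sliceAvg (F.erase i) ν (exch i j x) - sliceAvg F ν x) 0 := by
  rcases (opp F i x).eq_empty_or_nonempty with h | ⟨j, hj⟩
  · rw [h, sum_empty, sliceAvg_erase_of_opp_eq_empty hi ν h]; simp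
  · have : ∀ j' ∈ opp F i x, max (sliceAvg (F.erase i) ν (exch i j' x) - sliceAvg F ν x) 0 =
        max (sliceAvg (F.erase i) ν (exch i j x) - sliceAvg F ν x) 0 := fun j' hj' => by
      rw [sliceAvg_congr ν (exch_mem_freeSlice_erase hi (self_mem_freeSlice _ x) hj hj')]
    rw [sum_congr rfl this, sum_const, nsmul_eq_mul]
    rw [mul_max_of_nonneg _ _ (Nat.cast_nonneg _), mul_max_of_nonneg _ _ (Nat.cast_nonneg _),
      mul_zero, mul_zero]
    congr 1
    linarith [level_mul_sliceAvg_erase hi ν hj]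

/-- The kernel which, with probability `a x`, exchanges coordinate `i` with a uniformly chosen
coordinate of `F` carrying the opposite value. -/
def exchKernel (F : Finset (Fin n)) (i : Fin n) (a : (Fin n → Bool) → ℝ)
    (x y : Fin n → Bool) : ℝ :=
  (1 - a x) * (if y = x then 1 else 0) +
    a x / (opp F i x).card * ∑ j ∈ opp F i x, if y = exch i j x then 1 else 0

lemma sum_exchKernel_mul (F : Finset (Fin n)) (i : Fin n) (a φ : (Fin n → Bool) → ℝ)
    (x : Fin n → Bool) :
    ∑ y, exchKernel F i a x y * φ y =
      (1 - a x) * φ x + a x / (opp F i x).card * ∑ j ∈ opp F i x, φ (exch i j x) := by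
  simp only [exchKernel, add_mul, sum_add_distrib, mul_assoc, sum_mul, ← mul_sum]
  rw [sum_comm]
  simp

lemma sum_mul_exchKernel {F : Finset (Fin n)} {i : Fin n} (hi : i ∈ F)
    (a h : (Fin n → Bool) → ℝ) (y : Fin n → Bool) :
    ∑ x, h x * exchKernel F i a x y =
      h y - h y * a y + (∑ j ∈ opp F i y, h (exch i j y) * a (exch i j y)) /
        (level F (y i) y).card := by
  have h1 : ∀ x, h x * exchKernel F i a x y = (if x = y then h x * (1 - a x) else 0) +
      ∑ j ∈ opp F i x, h x * (a x / (opp F i x).card) * (if y = exch i j x then 1 else 0) := by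
    intro x
    rw [exchKernel, mul_add, ← mul_sum]
    by_cases hxy : x = y
    · subst hxy; simp; ring
    · simp [hxy, Ne.symm hxy]; ring
  simp only [h1, sum_add_distrib]
  rw [sum_sum_opp]
  simp only [exch_exch]
  have h2 : ∀ x, ∑ j ∈ opp F i x, h (exch i j x) * (a (exch i j x) /
      (opp F i (exch i j x)).card) * (if y = x then 1 else 0) =
      if y = x then (∑ j ∈ opp F i x, h (exch i j x) * a (exch i j x)) /
        (level F (x i) x).card else 0 := by
    intro x
    split_ifs
    · rw [sum_div]
      refine sum_congr rfl fun j hj => ?_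
      rw [card_opp_exch hi hj]; ring
    · simp
  simp only [h2]
  simp
  ring

/-- A Markov kernel which only changes the coordinates in `F`. -/
structure IsKernelOn (F : Finset (Fin n)) (p : (Fin n → Bool) → (Fin n → Bool) → ℝ) : Prop where
  nonneg : ∀ x y, 0 ≤ p x y
  sum_eq_one : ∀ x, ∑ y, p x y = 1
  eq_of_ne_zero : ∀ x y, p x y ≠ 0 → ∀ j, j ∉ F → y j = x j

/-- The probability that `p` changes the coordinate `j` of `x`. -/
def disp (p : (Fin n → Bool) → (Fin n → Bool) → ℝ) (x : Fin n → Bool) (j : Fin n) : ℝ :=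
  ∑ y, p x y * (if x j ≠ y j then (1 : ℝ) else 0)

/-- The weak transport cost of the kernel `p` started from `σ`. -/
def kernelCost (σ : (Fin n → Bool) → ℝ) (p : (Fin n → Bool) → (Fin n → Bool) → ℝ) : ℝ :=
  ∑ x, σ x * ∑ j, disp p x j ^ 2

/-- Composition of kernels. -/
def kernelComp (p q : (Fin n → Bool) → (Fin n → Bool) → ℝ) (x y : Fin n → Bool) : ℝ :=
  ∑ z, p x z * q z y

/-- The image of `σ` under the kernel `p`. -/
def push (σ : (Fin n → Bool) → ℝ) (p : (Fin n → Bool) → (Fin n → Bool) → ℝ)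
    (y : Fin n → Bool) : ℝ :=
  ∑ x, σ x * p x y

lemma push_nonneg {σ : (Fin n → Bool) → ℝ} {p : (Fin n → Bool) → (Fin n → Bool) → ℝ}
    (hσ : ∀ x, 0 ≤ σ x) (hp : ∀ x y, 0 ≤ p x y) (y : Fin n → Bool) : 0 ≤ push σ p y :=
  sum_nonneg fun x _ => mul_nonneg (hσ x) (hp x y)

lemma sum_push_mul (σ φ : (Fin n → Bool) → ℝ) (p : (Fin n → Bool) → (Fin n → Bool) → ℝ) :
    ∑ y, push σ p y * φ y = ∑ x, σ x * ∑ y, p x y * φ y := by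
  simp only [push, sum_mul, mul_sum]
  rw [sum_comm]
  simp only [mul_assoc]

lemma push_kernelComp (σ : (Fin n → Bool) → ℝ) (p q : (Fin n → Bool) → (Fin n → Bool) → ℝ)
    (y : Fin n → Bool) : push σ (kernelComp p q) y = push (push σ p) q y :=
  (sum_push_mul σ (fun z => q z y) p).symm

lemma disp_nonneg {p : (Fin n → Bool) → (Fin n → Bool) → ℝ} (hp : ∀ x y, 0 ≤ p x y)
    (x : Fin n → Bool) (j : Fin n) : 0 ≤ disp p x j :=
  sum_nonneg fun y _ => mul_nonneg (hp x y) (by split_ifs <;> norm_num)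

lemma kernelCost_nonneg {σ : (Fin n → Bool) → ℝ} (hσ : ∀ x, 0 ≤ σ x)
    (p : (Fin n → Bool) → (Fin n → Bool) → ℝ) : 0 ≤ kernelCost σ p :=
  sum_nonneg fun x _ => mul_nonneg (hσ x) (sum_nonneg fun _ _ => sq_nonneg _)

lemma IsKernelOn.disp_eq_zero {F : Finset (Fin n)} {p : (Fin n → Bool) → (Fin n → Bool) → ℝ}
    (hp : IsKernelOn F p) (x : Fin n → Bool) {j : Fin n} (hj : j ∉ F) : disp p x j = 0 := by
  refine sum_eq_zero fun y _ => ?_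
  by_cases h : p x y = 0
  · rw [h, zero_mul]
  · rw [if_neg (by rw [hp.eq_of_ne_zero x y h j hj]; simp), mul_zero]

lemma IsKernelOn.comp {F G : Finset (Fin n)} {p q : (Fin n → Bool) → (Fin n → Bool) → ℝ}
    (hp : IsKernelOn F p) (hq : IsKernelOn G q) (hG : G ⊆ F) :
    IsKernelOn F (kernelComp p q) where
  nonneg x y := sum_nonneg fun z _ => mul_nonneg (hp.nonneg x z) (hq.nonneg z y)
  sum_eq_one x := by
    simp only [kernelComp]
    rw [sum_comm]
    simp only [← mul_sum, hq.sum_eq_one, mul_one, hp.sum_eq_one]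
  eq_of_ne_zero x y h j hj := by
    obtain ⟨z, -, hz⟩ := exists_ne_zero_of_sum_ne_zero h
    rw [hq.eq_of_ne_zero z y (right_ne_zero_of_mul hz) j fun h' => hj (hG h'),
      hp.eq_of_ne_zero x z (left_ne_zero_of_mul hz) j hj]

lemma disp_kernelComp_le {F G : Finset (Fin n)} {p q : (Fin n → Bool) → (Fin n → Bool) → ℝ}
    (hp : IsKernelOn F p) (hq : IsKernelOn G q) (x : Fin n → Bool) (j : Fin n) :
    disp (kernelComp p q) x j ≤ disp p x j + ∑ z, p x z * disp q z j := by
  have h1 : disp p x j = ∑ z, p x z * ∑ y, q z y * (if x j ≠ z j then (1 : ℝ) else 0) := by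
    simp only [← sum_mul, hq.sum_eq_one, one_mul, disp]
  rw [h1, ← sum_add_distrib]
  simp only [disp, kernelComp, sum_mul]
  rw [sum_comm]
  refine sum_le_sum fun z _ => ?_
  rw [← mul_add, ← sum_add_distrib]
  simp only [mul_assoc]
  rw [← mul_sum]
  refine mul_le_mul_of_nonneg_left (sum_le_sum fun y _ => ?_) (hp.nonneg x z)
  rw [← mul_add]
  refine mul_le_mul_of_nonneg_left ?_ (hq.nonneg z y)
  cases x j <;> cases y j <;> cases z j <;> simp

lemma isKernelOn_exchKernel {F : Finset (Fin n)} {i : Fin n} (hi : i ∈ F)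
    {a : (Fin n → Bool) → ℝ} (ha0 : ∀ x, 0 ≤ a x) (ha1 : ∀ x, a x ≤ 1)
    (hopp : ∀ x, opp F i x = ∅ → a x = 0) : IsKernelOn F (exchKernel F i a) where
  nonneg x y := by
    refine add_nonneg (mul_nonneg (sub_nonneg.2 (ha1 x)) (by split_ifs <;> norm_num))
      (mul_nonneg (div_nonneg (ha0 x) (Nat.cast_nonneg _)) (sum_nonneg fun j _ => ?_))
    split_ifs <;> norm_num
  sum_eq_one x := by
    have h := sum_exchKernel_mul F i a (fun _ => 1) x
    simp only [mul_one, sum_const, nsmul_eq_mul] at h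
    rw [h]
    rcases (opp F i x).eq_empty_or_nonempty with h0 | h0
    · rw [hopp x h0]; simp
    · have : ((opp F i x).card : ℝ) ≠ 0 := by exact_mod_cast (card_pos.2 h0).ne'
      field_simp
      ring
  eq_of_ne_zero x y h j hj := by
    by_cases hxy : y = x
    · rw [hxy]
    · rw [exchKernel, if_neg hxy, mul_zero, zero_add] at h
      obtain ⟨l, hl, hl'⟩ := exists_ne_zero_of_sum_ne_zero (right_ne_zero_of_mul h)
      have hy : y = exch i l x := by
        by_contra hne
        exact hl' (if_neg hne)
      rw [hy]
      exact (mem_freeSlice.1 (exch_mem_freeSlice hi (mem_opp.1 hl).1 x)).1 j hj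

lemma disp_exchKernel_self {F : Finset (Fin n)} {i : Fin n}
    {a : (Fin n → Bool) → ℝ} (ha0 : ∀ x, 0 ≤ a x) (x : Fin n → Bool) :
    disp (exchKernel F i a) x i ≤ a x := by
  rw [disp, sum_exchKernel_mul]
  simp only [ne_eq, not_true_eq_false, if_false, mul_zero, zero_add]
  have h : ∑ j ∈ opp F i x, (if ¬ x i = exch i j x i then (1 : ℝ) else 0) ≤
      (opp F i x).card := by
    refine (sum_le_sum fun j _ => (?_ : _ ≤ (1 : ℝ))).trans (by simp)
    split_ifs <;> norm_num
  refine (mul_le_mul_of_nonneg_left h (div_nonneg (ha0 x) (Nat.cast_nonneg _))).trans ?_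
  rcases eq_or_ne ((opp F i x).card : ℝ) 0 with h0 | h0
  · rw [h0, mul_zero]; exact ha0 x
  · rw [div_mul_cancel₀ _ h0]

lemma disp_exchKernel_of_ne {F : Finset (Fin n)} {i j : Fin n} (hij : j ≠ i)
    (a : (Fin n → Bool) → ℝ) (x : Fin n → Bool) :
    disp (exchKernel F i a) x j =
      if j ∈ opp F i x then a x / (opp F i x).card else 0 := by
  rw [disp, sum_exchKernel_mul]
  simp only [ne_eq, not_true_eq_false, if_false, mul_zero, zero_add]
  have h : ∀ l ∈ opp F i x, (if ¬ x j = exch i l x j then (1 : ℝ) else 0) =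
      if j = l then 1 else 0 := by
    intro l hl
    by_cases hjl : j = l
    · subst hjl
      rw [exch_right, (mem_opp.1 hl).2]; cases x i <;> simp
    · rw [exch_of_ne x hij hjl]; simp [hjl]
  rw [sum_congr rfl h, sum_ite_eq]
  split_ifs <;> simp

lemma sq_sum_mul_le {X : Type*} [Fintype X] (w φ : X → ℝ) (hw : ∀ x, 0 ≤ w x)
    (hw1 : ∑ x, w x = 1) : (∑ x, w x * φ x) ^ 2 ≤ ∑ x, w x * φ x ^ 2 := by
  have := (even_two.convexOn_pow (𝕜 := ℝ)).map_sum_le (t := univ) (w := w) (p := φ)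
    (fun x _ => hw x) hw1 (fun x _ => Set.mem_univ _)
  simpa [smul_eq_mul] using this

/-- The uniform mixture over `i ∈ F` of an exchange at `i` followed by the kernel `R i`. -/
def mixKernel (F : Finset (Fin n)) (a : Fin n → (Fin n → Bool) → ℝ)
    (R : Fin n → (Fin n → Bool) → (Fin n → Bool) → ℝ) (x y : Fin n → Bool) : ℝ :=
  (∑ i ∈ F, kernelComp (exchKernel F i (a i)) (R i) x y) / F.card

lemma push_mixKernel (F : Finset (Fin n)) (a : Fin n → (Fin n → Bool) → ℝ)
    (R : Fin n → (Fin n → Bool) → (Fin n → Bool) → ℝ) (σ : (Fin n → Bool) → ℝ)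
    (y : Fin n → Bool) : push σ (mixKernel F a R) y =
      (∑ i ∈ F, push (push σ (exchKernel F i (a i))) (R i) y) / F.card := by
  simp only [← push_kernelComp]
  simp only [push, mixKernel, mul_div_assoc', ← sum_div, mul_sum]
  rw [sum_comm]

section Mix

variable {F : Finset (Fin n)} {a : Fin n → (Fin n → Bool) → ℝ}
  {R : Fin n → (Fin n → Bool) → (Fin n → Bool) → ℝ}

lemma isKernelOn_mixKernel (hF : F.Nonempty) (ha0 : ∀ i x, 0 ≤ a i x) (ha1 : ∀ i x, a i x ≤ 1)
    (hopp : ∀ i ∈ F, ∀ x, opp F i x = ∅ → a i x = 0)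
    (hR : ∀ i ∈ F, IsKernelOn (F.erase i) (R i)) : IsKernelOn F (mixKernel F a R) := by
  have hK : ∀ i ∈ F, IsKernelOn F (kernelComp (exchKernel F i (a i)) (R i)) := fun i hi =>
    (isKernelOn_exchKernel hi (ha0 i) (ha1 i) (hopp i hi)).comp (hR i hi) (erase_subset i F)
  refine ⟨fun x y => ?_, fun x => ?_, fun x y h j hj => ?_⟩
  · exact div_nonneg (sum_nonneg fun i hi => (hK i hi).nonneg x y) (Nat.cast_nonneg _)
  · simp only [mixKernel]
    rw [← sum_div, sum_comm, sum_congr rfl fun i hi => (hK i hi).sum_eq_one x]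
    have : (F.card : ℝ) ≠ 0 := by exact_mod_cast (card_pos.2 hF).ne'
    simp [this]
  · obtain ⟨i, hi, hi'⟩ := exists_ne_zero_of_sum_ne_zero (div_ne_zero_iff.1 h).1
    exact (hK i hi).eq_of_ne_zero x y hi' j hj

lemma disp_mixKernel_sq_le (hF : 2 ≤ F.card) (ha0 : ∀ i x, 0 ≤ a i x)
    (ha1 : ∀ i x, a i x ≤ 1) (hopp : ∀ i ∈ F, ∀ x, opp F i x = ∅ → a i x = 0)
    (hR : ∀ i ∈ F, IsKernelOn (F.erase i) (R i)) (x : Fin n → Bool) {j : Fin n} (hj : j ∈ F) :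
    disp (mixKernel F a R) x j ^ 2 ≤
      (2 * (a j x ^ 2 + (∑ i ∈ opp F j x, a i x / (opp F i x).card) ^ 2) +
        ∑ i ∈ F, ∑ z, exchKernel F i (a i) x z * disp (R i) z j ^ 2) / F.card := by
  have hK : ∀ i ∈ F, IsKernelOn F (exchKernel F i (a i)) := fun i hi =>
    isKernelOn_exchKernel hi (ha0 i) (ha1 i) (hopp i hi)
  set V := ∑ i ∈ opp F j x, a i x / (opp F i x).card with hV
  set W := ∑ i ∈ F.erase j, ∑ z, exchKernel F i (a i) x z * disp (R i) z j with hW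
  set S := ∑ i ∈ F, ∑ z, exchKernel F i (a i) x z * disp (R i) z j ^ 2 with hS
  have hm : (2 : ℝ) ≤ F.card := by exact_mod_cast hF
  have hcard : ((F.erase j).card : ℝ) = F.card - 1 := by
    rw [card_erase_of_mem hj, Nat.cast_sub (by omega)]; simp
  have hW0 : 0 ≤ W := sum_nonneg fun i hi => sum_nonneg fun z _ =>
    mul_nonneg ((hK i (mem_of_mem_erase hi)).nonneg x z)
      (disp_nonneg (hR i (mem_of_mem_erase hi)).nonneg z j)
  have hWS : W ^ 2 ≤ (F.card - 1) * S := by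
    rw [← hcard]
    refine sq_sum_le_card_mul_sum_sq.trans (mul_le_mul_of_nonneg_left ?_ (Nat.cast_nonneg _))
    refine (sum_le_sum fun i hi => sq_sum_mul_le _ _
      ((hK i (mem_of_mem_erase hi)).nonneg x) ((hK i (mem_of_mem_erase hi)).sum_eq_one x)).trans ?_
    exact sum_le_sum_of_subset_of_nonneg (erase_subset j F) fun i hi _ =>
      sum_nonneg fun z _ => mul_nonneg ((hK i hi).nonneg x z) (sq_nonneg _)
  have hle : disp (mixKernel F a R) x j ≤ (a j x + V + W) / F.card := by
    have h1 : disp (mixKernel F a R) x j =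
        (∑ i ∈ F, disp (kernelComp (exchKernel F i (a i)) (R i)) x j) / F.card := by
      simp only [disp, mixKernel, div_mul_eq_mul_div, ← sum_div, sum_mul]
      rw [sum_comm]
    rw [h1]
    refine div_le_div_of_nonneg_right ?_ (Nat.cast_nonneg _)
    refine (sum_le_sum fun i hi => disp_kernelComp_le (hK i hi) (hR i hi) x j).trans ?_
    rw [sum_add_distrib]
    refine add_le_add ?_ ?_
    · rw [← add_sum_erase F _ hj]
      refine add_le_add (disp_exchKernel_self (ha0 j) x) (le_of_eq ?_)
      rw [hV, sum_congr rfl fun i hi =>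
        disp_exchKernel_of_ne (F := F) (ne_of_mem_erase hi).symm (a i) x, ← sum_filter]
      refine sum_congr ?_ fun _ _ => rfl
      ext i
      rw [mem_filter, mem_erase]
      constructor
      · rintro ⟨⟨_, hi⟩, h⟩
        exact (mem_opp_comm hi hj).1 h
      · intro h
        have hi := (mem_opp.1 h).1
        refine ⟨⟨?_, hi⟩, (mem_opp_comm hj hi).1 h⟩
        rintro rfl
        have := (mem_opp.1 h).2
        cases hx : x i <;> simp [hx] at this
    · rw [← add_sum_erase F _ hj, sum_eq_zero fun z _ => by
        rw [(hR j hj).disp_eq_zero z (notMem_erase j F), mul_zero], zero_add]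
  have hd0 : 0 ≤ disp (mixKernel F a R) x j :=
    disp_nonneg (isKernelOn_mixKernel ⟨j, hj⟩ ha0 ha1 hopp hR).nonneg x j
  refine (pow_le_pow_left₀ hd0 hle 2).trans ?_
  rw [div_pow, div_le_div_iff₀ (by positivity) (by positivity)]
  have h2 : (a j x + V + W) ^ 2 ≤ F.card * (2 * (a j x ^ 2 + V ^ 2) + S) := by
    have hm1 : (0 : ℝ) < F.card - 1 := by linarith
    refine le_of_mul_le_mul_left ?_ hm1
    nlinarith [sq_nonneg ((F.card - 1) * (a j x + V) - W), sq_nonneg (a j x - V),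
      mul_nonneg (mul_nonneg hm1.le (by linarith : (0 : ℝ) ≤ F.card)) (sq_nonneg (a j x - V)),
      mul_le_mul_of_nonneg_left hWS (by linarith : (0 : ℝ) ≤ F.card)]
  calc (a j x + V + W) ^ 2 * F.card ≤ F.card * (2 * (a j x ^ 2 + V ^ 2) + S) * F.card :=
        mul_le_mul_of_nonneg_right h2 (Nat.cast_nonneg _)
    _ = _ := by ring

lemma kernelCost_mixKernel_le (hF : 2 ≤ F.card) (ha0 : ∀ i x, 0 ≤ a i x)
    (ha1 : ∀ i x, a i x ≤ 1) (hopp : ∀ i ∈ F, ∀ x, opp F i x = ∅ → a i x = 0)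
    (hR : ∀ i ∈ F, IsKernelOn (F.erase i) (R i)) {σ : (Fin n → Bool) → ℝ}
    (hσ : ∀ x, 0 ≤ σ x) :
    kernelCost σ (mixKernel F a R) ≤
      (2 * ∑ x, σ x * ∑ j ∈ F, (a j x ^ 2 + (∑ i ∈ opp F j x, a i x / (opp F i x).card) ^ 2) +
        ∑ i ∈ F, kernelCost (push σ (exchKernel F i (a i))) (R i)) / F.card := by
  have hne : F.Nonempty := card_pos.1 (by omega)
  have hk := isKernelOn_mixKernel hne ha0 ha1 hopp hR
  have h1 : ∀ i, kernelCost (push σ (exchKernel F i (a i))) (R i) =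
      ∑ x, σ x * ∑ j, ∑ z, exchKernel F i (a i) x z * disp (R i) z j ^ 2 := by
    intro i
    rw [kernelCost, sum_push_mul]
    refine sum_congr rfl fun x _ => ?_
    simp only [mul_sum]
    rw [sum_comm]
  simp only [h1]
  rw [sum_comm, mul_sum, ← sum_add_distrib, sum_div, kernelCost]
  refine sum_le_sum fun x _ => ?_
  rw [← mul_sum, mul_left_comm, ← mul_add, mul_div_assoc]
  refine mul_le_mul_of_nonneg_left ?_ (hσ x)
  rw [← sum_subset (subset_univ F) fun j _ hj => by rw [hk.disp_eq_zero x hj]; simp]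
  refine (sum_le_sum fun j hj => disp_mixKernel_sq_le hF ha0 ha1 hopp hR x hj).trans ?_
  rw [← sum_div, sum_add_distrib, ← mul_sum]
  refine div_le_div_of_nonneg_right (add_le_add le_rfl ?_) (Nat.cast_nonneg _)
  rw [sum_comm]
  refine sum_le_sum fun i hi => sum_le_sum_of_subset_of_nonneg (subset_univ F) fun j _ _ =>
    sum_nonneg fun z _ => mul_nonneg
      ((isKernelOn_exchKernel hi (ha0 i) (ha1 i) (hopp i hi)).nonneg x z) (sq_nonneg _)

end Mix

/-- The entropy of `ν` relative to its average over free slices. -/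
def sliceEnt (F : Finset (Fin n)) (ν : (Fin n → Bool) → ℝ) : ℝ :=
  ∑ x, ν x * Real.log (ν x / sliceAvg F ν x)

/-- The entropy carried by the coordinate `i` alone. -/
def coordEnt (F : Finset (Fin n)) (i : Fin n) (ν : (Fin n → Bool) → ℝ) : ℝ :=
  ∑ x, sliceAvg (F.erase i) ν x * Real.log (sliceAvg (F.erase i) ν x / sliceAvg F ν x)

lemma sliceAvg_congr_erase {F : Finset (Fin n)} {i : Fin n} (hi : i ∈ F)
    (ν : (Fin n → Bool) → ℝ) {x y : Fin n → Bool} (h : y ∈ freeSlice (F.erase i) x) :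
    sliceAvg F ν y = sliceAvg F ν x :=
  sliceAvg_congr ν ((mem_freeSlice_erase hi).1 h).1

lemma sliceAvg_erase_eq_zero {F : Finset (Fin n)} {i : Fin n} (hi : i ∈ F)
    {ν : (Fin n → Bool) → ℝ} (hν : ∀ x, 0 ≤ ν x) {x : Fin n → Bool}
    (h : sliceAvg F ν x = 0) : sliceAvg (F.erase i) ν x = 0 := by
  rw [sliceAvg, sum_eq_zero, zero_div]
  intro y hy
  refine eq_zero_of_sliceAvg_eq_zero (F := F) hν ?_
  rw [sliceAvg_congr_erase hi ν hy, h]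

lemma sliceEnt_eq_add_coordEnt {F : Finset (Fin n)} {i : Fin n} (hi : i ∈ F)
    {ν : (Fin n → Bool) → ℝ} (hν : ∀ x, 0 ≤ ν x) :
    sliceEnt F ν = sliceEnt (F.erase i) ν + coordEnt F i ν := by
  rw [coordEnt, sum_sliceAvg_mul, sliceEnt, sliceEnt, ← sum_add_distrib]
  · refine sum_congr rfl fun x _ => ?_
    by_cases h : ν x = 0
    · rw [h]; simp
    · have hg : sliceAvg (F.erase i) ν x ≠ 0 := fun h0 => h (eq_zero_of_sliceAvg_eq_zero hν h0)
      have hf : sliceAvg F ν x ≠ 0 := fun h0 => h (eq_zero_of_sliceAvg_eq_zero hν h0)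
      rw [← mul_add, ← Real.log_mul (div_ne_zero h hg) (div_ne_zero hg hf),
        div_mul_div_cancel₀ hg]
  · intro x y hy
    rw [sliceAvg_congr ν hy, sliceAvg_congr_erase hi ν hy]

lemma posPart_sq_div_add_le {f g : ℝ} (hf : 0 ≤ f) (hg : 0 ≤ g) (h : f = 0 → g = 0) :
    max (g - f) 0 ^ 2 / g + max (f - g) 0 ^ 2 / f ≤ 2 * (g * Real.log (g / f) - g + f) := by
  rcases hf.eq_or_lt with rfl | hf
  · simp [h rfl]
  rcases hg.eq_or_lt with rfl | hg
  · rw [max_eq_right (by linarith), max_eq_left (by linarith)]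
    simp only [zero_mul, sub_zero, div_zero, zero_add, ne_eq, OfNat.ofNat_ne_zero,
      not_false_eq_true, zero_pow]
    rw [div_le_iff₀ hf]; nlinarith
  rcases le_total g f with hgf | hgf
  · rw [max_eq_right (by linarith), max_eq_left (by linarith)]
    have h1 : Real.log (f / g) ≤ (f / g - (f / g)⁻¹) / 2 := by
      rw [← Real.sinh_log (div_pos hf hg), Real.self_le_sinh_iff]
      exact Real.log_nonneg ((one_le_div hg).2 hgf)
    rw [← inv_div f g, Real.log_inv]
    have h2 : g * Real.log (f / g) ≤ (f - g ^ 2 / f) / 2 := by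
      refine (mul_le_mul_of_nonneg_left h1 hg.le).trans (le_of_eq ?_)
      field_simp
    have h3 : (f - g) ^ 2 / f = f - 2 * g + g ^ 2 / f := by field_simp; ring
    rw [h3]
    simp only [ne_eq, OfNat.ofNat_ne_zero, not_false_eq_true, zero_pow, zero_div, zero_add]
    linarith
  · rw [max_eq_left (by linarith), max_eq_right (by linarith)]
    have h1 := Real.le_log_one_add_of_nonneg (div_nonneg (sub_nonneg.2 hgf) hf.le)
    have h0 : 1 + (g - f) / f = g / f := by field_simp; ring
    rw [h0] at h1
    have h2 : 2 * ((g - f) / f) / ((g - f) / f + 2) = 2 * (g - f) / (g + f) := by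
      have : g - f + f * 2 ≠ 0 := by nlinarith
      have : g + f ≠ 0 := by positivity
      field_simp
      ring
    rw [h2] at h1
    have h3 := mul_le_mul_of_nonneg_left h1 hg.le
    have h4 : (g - f) ^ 2 / g ≤ 2 * (g * (2 * (g - f) / (g + f)) - g + f) := by
      have h5 : 2 * (g * (2 * (g - f) / (g + f)) - g + f) - (g - f) ^ 2 / g =
          (g - f) ^ 3 / (g * (g + f)) := by
        have : g + f ≠ 0 := by positivity
        field_simp
        ring
      have : 0 ≤ (g - f) ^ 3 / (g * (g + f)) :=
        div_nonneg (pow_nonneg (sub_nonneg.2 hgf) 3) (by positivity)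
      linarith
    simp only [ne_eq, OfNat.ofNat_ne_zero, not_false_eq_true, zero_pow, zero_div, add_zero]
    linarith

lemma sum_posPart_sq_le_coordEnt {F : Finset (Fin n)} {i : Fin n} (hi : i ∈ F)
    {ν : (Fin n → Bool) → ℝ} (hν : ∀ x, 0 ≤ ν x) :
    ∑ x, max (sliceAvg (F.erase i) ν x - sliceAvg F ν x) 0 ^ 2 / sliceAvg (F.erase i) ν x +
      ∑ x, max (sliceAvg F ν x - sliceAvg (F.erase i) ν x) 0 ^ 2 / sliceAvg F ν x ≤
      2 * coordEnt F i ν := by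
  rw [← sum_add_distrib]
  refine (sum_le_sum fun x _ => posPart_sq_div_add_le (sliceAvg_nonneg F hν x)
    (sliceAvg_nonneg (F.erase i) hν x) (sliceAvg_erase_eq_zero hi hν)).trans (le_of_eq ?_)
  rw [← mul_sum, sum_add_distrib, sum_sub_distrib, sum_sliceAvg, sum_sliceAvg, coordEnt]
  ring

lemma coordEnt_nonneg {F : Finset (Fin n)} {i : Fin n} (hi : i ∈ F)
    {ν : (Fin n → Bool) → ℝ} (hν : ∀ x, 0 ≤ ν x) : 0 ≤ coordEnt F i ν := by
  have h1 := sum_posPart_sq_le_coordEnt hi hν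
  have h2 := sum_nonneg fun x (_ : x ∈ univ) => div_nonneg (sq_nonneg
    (max (sliceAvg (F.erase i) ν x - sliceAvg F ν x) 0)) (sliceAvg_nonneg (F.erase i) hν x)
  have h3 := sum_nonneg fun x (_ : x ∈ univ) => div_nonneg (sq_nonneg
    (max (sliceAvg F ν x - sliceAvg (F.erase i) ν x) 0)) (sliceAvg_nonneg F hν x)
  linarith

/-- The data processing inequality for relative entropy. -/
lemma sum_push_mul_log_le {F : Finset (Fin n)} {ν h : (Fin n → Bool) → ℝ}
    {K : (Fin n → Bool) → (Fin n → Bool) → ℝ} (hK : IsKernelOn F K) (hν : ∀ x, 0 ≤ ν x)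
    (hh : ∀ x, 0 ≤ h x) (hac : ∀ x, h x = 0 → ν x = 0) :
    ∑ y, push ν K y * Real.log (push ν K y / push h K y) ≤
      ∑ x, ν x * Real.log (ν x / h x) := by
  have key : ∀ y, push ν K y * Real.log (push ν K y / push h K y) ≤
      ∑ x, ν x * K x y * Real.log (ν x / h x) := by
    intro y
    have h1 : ∀ x, ν x * K x y * Real.log (push ν K y / push h K y) ≤
        ν x * K x y * Real.log (ν x / h x) - ν x * K x y +
          h x * K x y * (push ν K y / push h K y) := by
      intro x
      have hU0 := push_nonneg hν hK.nonneg y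
      have hV0 := push_nonneg hh hK.nonneg y
      by_cases h0 : ν x * K x y = 0
      · rw [h0]
        have := mul_nonneg (mul_nonneg (hh x) (hK.nonneg x y)) (div_nonneg hU0 hV0)
        linarith
      · have hνx : 0 < ν x := (hν x).lt_of_ne' (left_ne_zero_of_mul h0)
        have hKx : 0 < K x y := (hK.nonneg x y).lt_of_ne' (right_ne_zero_of_mul h0)
        have hhx : 0 < h x := (hh x).lt_of_ne' fun hx => hνx.ne' (hac x hx)
        have hU : 0 < push ν K y := (mul_pos hνx hKx).trans_le
          (single_le_sum (f := fun x => ν x * K x y)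
            (fun x _ => mul_nonneg (hν x) (hK.nonneg x y)) (mem_univ x))
        have hV : 0 < push h K y := (mul_pos hhx hKx).trans_le
          (single_le_sum (f := fun x => h x * K x y)
            (fun x _ => mul_nonneg (hh x) (hK.nonneg x y)) (mem_univ x))
        have hlog := Real.log_le_sub_one_of_pos
          (div_pos (div_pos hU hV) (div_pos hνx hhx))
        rw [Real.log_div (div_pos hU hV).ne' (div_pos hνx hhx).ne'] at hlog
        have := mul_le_mul_of_nonneg_left hlog (mul_pos hνx hKx).le
        have h2 : ν x * K x y * (push ν K y / push h K y / (ν x / h x) - 1) =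
            h x * K x y * (push ν K y / push h K y) - ν x * K x y := by
          field_simp
        rw [h2] at this
        linarith
    have h2 := sum_le_sum fun x (_ : x ∈ univ) => h1 x
    rw [← sum_mul, sum_add_distrib, sum_sub_distrib, ← sum_mul] at h2
    change push ν K y * _ ≤ _ - push ν K y + push h K y * _ at h2
    have h3 : push h K y * (push ν K y / push h K y) ≤ push ν K y := by
      by_cases h0 : push h K y = 0
      · rw [h0, zero_mul]; exact push_nonneg hν hK.nonneg y
      · rw [mul_div_cancel₀ _ h0]
    linarith
  refine (sum_le_sum fun y _ => key y).trans (le_of_eq ?_)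
  rw [sum_comm]
  refine sum_congr rfl fun x _ => ?_
  rw [← sum_mul, ← mul_sum, hK.sum_eq_one, mul_one]

/-- Exchange probability moving the law of a coordinate to the uniform one. -/
def flattenProb (F : Finset (Fin n)) (ν : (Fin n → Bool) → ℝ) (i : Fin n)
    (x : Fin n → Bool) : ℝ :=
  max (sliceAvg (F.erase i) ν x - sliceAvg F ν x) 0 / sliceAvg (F.erase i) ν x

/-- Exchange probability moving the uniform law of a coordinate to that under `ν`. -/
def shapeProb (F : Finset (Fin n)) (ν : (Fin n → Bool) → ℝ) (i : Fin n)
    (x : Fin n → Bool) : ℝ :=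
  max (sliceAvg F ν x - sliceAvg (F.erase i) ν x) 0 / sliceAvg F ν x

section Prob

variable {F : Finset (Fin n)} {i : Fin n} {ν : (Fin n → Bool) → ℝ}

lemma flattenProb_nonneg (hν : ∀ x, 0 ≤ ν x) (i : Fin n) (x : Fin n → Bool) :
    0 ≤ flattenProb F ν i x :=
  div_nonneg (le_max_right _ _) (sliceAvg_nonneg _ hν x)

lemma shapeProb_nonneg (hν : ∀ x, 0 ≤ ν x) (i : Fin n) (x : Fin n → Bool) :
    0 ≤ shapeProb F ν i x :=
  div_nonneg (le_max_right _ _) (sliceAvg_nonneg _ hν x)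

lemma flattenProb_le_one (hν : ∀ x, 0 ≤ ν x) (i : Fin n) (x : Fin n → Bool) :
    flattenProb F ν i x ≤ 1 :=
  div_le_one_of_le₀ (max_le (sub_le_self _ (sliceAvg_nonneg _ hν x)) (sliceAvg_nonneg _ hν x))
    (sliceAvg_nonneg _ hν x)

lemma shapeProb_le_one (hν : ∀ x, 0 ≤ ν x) (i : Fin n) (x : Fin n → Bool) :
    shapeProb F ν i x ≤ 1 :=
  div_le_one_of_le₀ (max_le (sub_le_self _ (sliceAvg_nonneg _ hν x)) (sliceAvg_nonneg _ hν x))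
    (sliceAvg_nonneg _ hν x)

lemma flattenProb_of_opp_eq_empty (hi : i ∈ F) {x : Fin n → Bool} (h : opp F i x = ∅) :
    flattenProb F ν i x = 0 := by
  rw [flattenProb, sliceAvg_erase_of_opp_eq_empty hi ν h]; simp

lemma shapeProb_of_opp_eq_empty (hi : i ∈ F) {x : Fin n → Bool} (h : opp F i x = ∅) :
    shapeProb F ν i x = 0 := by
  rw [shapeProb, sliceAvg_erase_of_opp_eq_empty hi ν h]; simp

lemma mul_flattenProb (hν : ∀ x, 0 ≤ ν x) (x : Fin n → Bool) :
    sliceAvg (F.erase i) ν x * flattenProb F ν i x =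
      max (sliceAvg (F.erase i) ν x - sliceAvg F ν x) 0 := by
  by_cases h : sliceAvg (F.erase i) ν x = 0
  · rw [h, zero_mul, max_eq_right]; linarith [sliceAvg_nonneg F hν x]
  · rw [flattenProb, mul_div_cancel₀ _ h]

lemma mul_shapeProb (hν : ∀ x, 0 ≤ ν x) (x : Fin n → Bool) :
    sliceAvg F ν x * shapeProb F ν i x =
      max (sliceAvg F ν x - sliceAvg (F.erase i) ν x) 0 := by
  by_cases h : sliceAvg F ν x = 0
  · rw [h, zero_mul, max_eq_right]; linarith [sliceAvg_nonneg (F.erase i) hν x]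
  · rw [shapeProb, mul_div_cancel₀ _ h]

lemma push_flatten (hi : i ∈ F) (hν : ∀ x, 0 ≤ ν x) (y : Fin n → Bool) :
    push (sliceAvg (F.erase i) ν) (exchKernel F i (flattenProb F ν i)) y = sliceAvg F ν y := by
  have h1 : ∑ j ∈ opp F i y, sliceAvg (F.erase i) ν (exch i j y) *
      flattenProb F ν i (exch i j y) =
      ∑ j ∈ opp F i y, max (sliceAvg (F.erase i) ν (exch i j y) - sliceAvg F ν y) 0 :=
    sum_congr rfl fun j hj => by
      rw [mul_flattenProb hν, sliceAvg_congr ν (exch_mem_freeSlice hi (mem_opp.1 hj).1 y)]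
  rw [push, sum_mul_exchKernel hi, h1, ← level_mul_negPart hi, mul_flattenProb hν,
    mul_div_cancel_left₀ _ (card_level_pos hi y).ne']
  rcases le_total (sliceAvg (F.erase i) ν y) (sliceAvg F ν y) with h | h
  · rw [max_eq_right (by linarith), max_eq_left (by linarith)]; ring
  · rw [max_eq_left (by linarith), max_eq_right (by linarith)]; ring

lemma push_shape (hi : i ∈ F) (hν : ∀ x, 0 ≤ ν x) (y : Fin n → Bool) :
    push (sliceAvg F ν) (exchKernel F i (shapeProb F ν i)) y = sliceAvg (F.erase i) ν y := by
  have h1 : ∑ j ∈ opp F i y, sliceAvg F ν (exch i j y) * shapeProb F ν i (exch i j y) =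
      ∑ j ∈ opp F i y, max (sliceAvg F ν y - sliceAvg (F.erase i) ν (exch i j y)) 0 :=
    sum_congr rfl fun j hj => by
      rw [mul_shapeProb hν, sliceAvg_congr ν (exch_mem_freeSlice hi (mem_opp.1 hj).1 y)]
  rw [push, sum_mul_exchKernel hi, h1, ← level_mul_posPart hi, mul_shapeProb hν,
    mul_div_cancel_left₀ _ (card_level_pos hi y).ne']
  rcases le_total (sliceAvg (F.erase i) ν y) (sliceAvg F ν y) with h | h
  · rw [max_eq_left (by linarith), max_eq_right (by linarith)]; ring
  · rw [max_eq_right (by linarith), max_eq_left (by linarith)]; ring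

lemma card_opp_congr (hi : i ∈ F) {x y : Fin n → Bool} (h : y ∈ freeSlice (F.erase i) x) :
    (opp F i y).card = (opp F i x).card := by
  rw [mem_freeSlice_erase hi] at h
  rw [opp, opp, card_level_congr _ h.1, h.2]

lemma flattenProb_congr (hi : i ∈ F) {x y : Fin n → Bool} (h : y ∈ freeSlice (F.erase i) x) :
    flattenProb F ν i y = flattenProb F ν i x := by
  rw [flattenProb, flattenProb, sliceAvg_congr ν h, sliceAvg_congr_erase hi ν h]

lemma sliceAvg_erase_push_flatten (hi : i ∈ F) (hν : ∀ x, 0 ≤ ν x) (z : Fin n → Bool) :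
    sliceAvg (F.erase i) (push ν (exchKernel F i (flattenProb F ν i))) z = sliceAvg F ν z := by
  set φ : (Fin n → Bool) → ℝ := fun y => if y ∈ freeSlice (F.erase i) z then 1 else 0 with hφ
  have hφc : ∀ x, ∀ y ∈ freeSlice (F.erase i) x, φ y = φ x := by
    intro x y hy
    have hiff : y ∈ freeSlice (F.erase i) z ↔ x ∈ freeSlice (F.erase i) z := by
      rw [freeSlice_symm, freeSlice_congr hy, ← freeSlice_symm]
    simp only [hφ, hiff]
  have hsum : ∀ ψ : (Fin n → Bool) → ℝ, ∑ y ∈ freeSlice (F.erase i) z, ψ y =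
      ∑ y, ψ y * φ y := by
    intro ψ; simp [hφ]
  refine mul_left_cancel₀ (freeSlice_card_pos (F.erase i) z).ne' ?_
  have h1 : (freeSlice (F.erase i) z).card * sliceAvg F ν z =
      ∑ y ∈ freeSlice (F.erase i) z, sliceAvg F ν y := by
    rw [sum_congr rfl fun y hy => sliceAvg_congr_erase hi ν hy, sum_const, nsmul_eq_mul]
  rw [card_mul_sliceAvg, h1, hsum, hsum, sum_push_mul]
  simp only [← push_flatten hi hν]
  rw [sum_push_mul, sum_sliceAvg_mul]
  intro x y hy
  rw [sum_exchKernel_mul, sum_exchKernel_mul, flattenProb_congr hi hy, hφc x y hy,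
    card_opp_congr hi hy]
  congr 2
  rcases (opp F i x).eq_empty_or_nonempty with h | ⟨j, hj⟩
  · have h' : opp F i y = ∅ := by
      rw [← card_eq_zero, card_opp_congr hi hy, h, card_empty]
    rw [h, h', sum_empty, sum_empty]
  · rw [sum_congr rfl fun j' hj' => hφc _ _ (exch_mem_freeSlice_erase hi hy hj hj'),
      sum_congr rfl fun j' hj' => hφc _ _
        (exch_mem_freeSlice_erase hi (self_mem_freeSlice _ x) hj hj'),
      sum_const, sum_const, card_opp_congr hi hy]

lemma sliceEnt_erase_push_flatten_le (hi : i ∈ F) (hν : ∀ x, 0 ≤ ν x) :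
    sliceEnt (F.erase i) (push ν (exchKernel F i (flattenProb F ν i))) ≤
      sliceEnt (F.erase i) ν := by
  have h1 := sum_push_mul_log_le (isKernelOn_exchKernel hi (flattenProb_nonneg (F := F) hν i)
    (flattenProb_le_one hν i) fun x => flattenProb_of_opp_eq_empty hi) hν
    (sliceAvg_nonneg (F.erase i) hν) (fun x => eq_zero_of_sliceAvg_eq_zero hν)
  simp only [push_flatten hi hν] at h1
  simp only [sliceEnt, sliceAvg_erase_push_flatten hi hν]
  exact h1

end Prob

lemma sum_sq_sum_opp_le (F : Finset (Fin n)) (x : Fin n → Bool) (u : Fin n → ℝ) :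
    ∑ j ∈ F, (∑ i ∈ opp F j x, u i / (opp F i x).card) ^ 2 ≤
      ∑ i ∈ F, ((level F (x i) x).card : ℝ) / (opp F i x).card * u i ^ 2 := by
  have h1 : ∀ j ∈ F, (∑ i ∈ opp F j x, u i / (opp F i x).card) ^ 2 ≤
      ∑ i ∈ F, if i ∈ opp F j x then
        ((level F (x i) x).card : ℝ) * (u i / (opp F i x).card) ^ 2 else 0 := by
    intro j hj
    refine sq_sum_le_card_mul_sum_sq.trans (le_of_eq ?_)
    rw [← sum_filter, filter_mem_eq_inter,
      inter_eq_right.2 (show opp F j x ⊆ F from filter_subset _ _), mul_sum]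
    refine sum_congr rfl fun i hi => ?_
    rw [opp, ← (mem_opp.1 hi).2]
  refine (sum_le_sum h1).trans (le_of_eq ?_)
  rw [sum_comm]
  refine sum_congr rfl fun i hi => ?_
  rw [← sum_filter, filter_congr fun j hj => mem_opp_comm hj hi, filter_mem_eq_inter,
    inter_eq_right.2 (show opp F i x ⊆ F from filter_subset _ _), sum_const, nsmul_eq_mul]
  by_cases h : ((opp F i x).card : ℝ) = 0
  · rw [h]; simp
  · field_simp

section Flatten

variable {F : Finset (Fin n)} {i : Fin n} {ν : (Fin n → Bool) → ℝ}

lemma sum_mul_flattenProb_sq (hi : i ∈ F) (hν : ∀ x, 0 ≤ ν x) :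
    ∑ x, ν x * flattenProb F ν i x ^ 2 =
      ∑ x, max (sliceAvg (F.erase i) ν x - sliceAvg F ν x) 0 ^ 2 / sliceAvg (F.erase i) ν x := by
  rw [← sum_sliceAvg_mul (F.erase i)]
  · refine sum_congr rfl fun x _ => ?_
    rw [sq, ← mul_assoc, mul_flattenProb hν, flattenProb]
    ring
  · intro x y hy
    rw [flattenProb_congr hi hy]

lemma level_div_opp_mul_flattenProb_le (hi : i ∈ F) (hν : ∀ x, 0 ≤ ν x) (x : Fin n → Bool) :
    sliceAvg (F.erase i) ν x *
        (((level F (x i) x).card : ℝ) / (opp F i x).card * flattenProb F ν i x ^ 2) ≤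
      ∑ j ∈ opp F i x, ((level F (x i) x).card : ℝ)⁻¹ *
        (max (sliceAvg F ν x - sliceAvg (F.erase i) ν (exch i j x)) 0 ^ 2 / sliceAvg F ν x) := by
  have hf := sliceAvg_nonneg F hν x
  have hg := sliceAvg_nonneg (F.erase i) hν x
  have hk := card_level_pos hi x
  have hrhs : 0 ≤ ∑ j ∈ opp F i x, ((level F (x i) x).card : ℝ)⁻¹ *
      (max (sliceAvg F ν x - sliceAvg (F.erase i) ν (exch i j x)) 0 ^ 2 / sliceAvg F ν x) :=
    sum_nonneg fun j _ => mul_nonneg (inv_nonneg.2 hk.le) (div_nonneg (sq_nonneg _) hf)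
  rcases hf.eq_or_lt with hf0 | hf0
  · rwa [sliceAvg_erase_eq_zero hi hν hf0.symm, zero_mul]
  have h1 : sliceAvg (F.erase i) ν x * flattenProb F ν i x ^ 2 ≤
      max (sliceAvg (F.erase i) ν x - sliceAvg F ν x) 0 ^ 2 / sliceAvg F ν x := by
    rw [sq, ← mul_assoc, mul_flattenProb hν, flattenProb, mul_div_assoc', ← sq]
    rcases le_total (sliceAvg (F.erase i) ν x) (sliceAvg F ν x) with h | h
    · rw [max_eq_right (by linarith)]; simp
    · gcongr
  rcases (opp F i x).eq_empty_or_nonempty with h0 | h0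
  · rw [h0]; simp
  have hl : (0 : ℝ) < (opp F i x).card := by exact_mod_cast h0.card_pos
  have h2 := sq_sum_le_card_mul_sum_sq (s := opp F i x)
    (f := fun j => max (sliceAvg F ν x - sliceAvg (F.erase i) ν (exch i j x)) 0)
  rw [← level_mul_posPart hi] at h2
  rw [← mul_sum, ← sum_div, mul_left_comm]
  refine (mul_le_mul_of_nonneg_left h1 (div_nonneg hk.le hl.le)).trans ?_
  rw [div_mul_div_comm, inv_mul_eq_div, div_div, div_le_div_iff₀ (by positivity) (by positivity)]
  have h3 := mul_le_mul_of_nonneg_right h2 hf0.le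
  nlinarith [h3]

lemma sum_level_div_opp_mul_flattenProb_le (hi : i ∈ F) (hν : ∀ x, 0 ≤ ν x) :
    ∑ x, ν x * (((level F (x i) x).card : ℝ) / (opp F i x).card * flattenProb F ν i x ^ 2) ≤
      ∑ x, max (sliceAvg F ν x - sliceAvg (F.erase i) ν x) 0 ^ 2 / sliceAvg F ν x := by
  rw [← sum_sliceAvg_mul (F.erase i)]
  · refine (sum_le_sum fun x _ => level_div_opp_mul_flattenProb_le hi hν x).trans ?_
    rw [sum_sum_opp]
    refine sum_le_sum fun x _ => ?_
    have hq : 0 ≤ max (sliceAvg F ν x - sliceAvg (F.erase i) ν x) 0 ^ 2 / sliceAvg F ν x :=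
      div_nonneg (sq_nonneg _) (sliceAvg_nonneg F hν x)
    rw [sum_congr rfl fun j hj => by
      rw [card_level_exch hi hj, exch_exch,
        sliceAvg_congr ν (exch_mem_freeSlice hi (mem_opp.1 hj).1 x)], sum_const, nsmul_eq_mul,
      ← mul_assoc]
    exact mul_le_of_le_one_left hq mul_inv_le_one
  · intro x y hy
    rw [flattenProb_congr hi hy, card_opp_congr hi hy, ((mem_freeSlice_erase hi).1 hy).2,
      card_level_congr _ ((mem_freeSlice_erase hi).1 hy).1]

end Flatten

lemma sum_flattenProb_sq_le {F : Finset (Fin n)} {ν : (Fin n → Bool) → ℝ}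
    (hν : ∀ x, 0 ≤ ν x) :
    ∑ x, ν x * ∑ j ∈ F, (flattenProb F ν j x ^ 2 +
      (∑ i ∈ opp F j x, flattenProb F ν i x / (opp F i x).card) ^ 2) ≤
      ∑ i ∈ F, 2 * coordEnt F i ν := by
  have h1 : ∀ x, ν x * ∑ j ∈ F, (flattenProb F ν j x ^ 2 +
      (∑ i ∈ opp F j x, flattenProb F ν i x / (opp F i x).card) ^ 2) ≤
      ∑ i ∈ F, (ν x * flattenProb F ν i x ^ 2 + ν x *
        (((level F (x i) x).card : ℝ) / (opp F i x).card * flattenProb F ν i x ^ 2)) := by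
    intro x
    rw [sum_add_distrib, sum_add_distrib, mul_add, ← mul_sum, ← mul_sum]
    exact add_le_add_right (mul_le_mul_of_nonneg_left
      (sum_sq_sum_opp_le F x fun i => flattenProb F ν i x) (hν x)) _
  refine (sum_le_sum fun x _ => h1 x).trans ?_
  rw [sum_comm]
  refine sum_le_sum fun i hi => ?_
  rw [sum_add_distrib, sum_mul_flattenProb_sq hi hν]
  linarith [sum_level_div_opp_mul_flattenProb_le hi hν, sum_posPart_sq_le_coordEnt hi hν]

lemma freeSlice_of_card_le_one {F : Finset (Fin n)} (hF : F.card ≤ 1) (x : Fin n → Bool) :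
    freeSlice F x = {x} := by
  rcases F.eq_empty_or_nonempty with rfl | ⟨i, hi⟩
  · ext y
    rw [mem_freeSlice, mem_singleton]
    constructor
    · exact fun h => funext fun j => h.1 j (notMem_empty j)
    · rintro rfl; simp
  · have h0 : opp F i x = ∅ := by
      rw [eq_empty_iff_forall_notMem]
      intro j hj
      have hji := mem_opp.1 hj
      rw [card_le_one.1 hF j hji.1 i hi] at hji
      exact (Bool.eq_not_self (x i)).mp hji.2
    rw [← freeSlice_erase_eq hi h0]
    have h1 : F.erase i = ∅ := by
      rw [← card_eq_zero, card_erase_of_mem hi]; omega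
    rw [h1]
    ext y
    rw [mem_freeSlice, mem_singleton]
    constructor
    · exact fun h => funext fun j => h.1 j (notMem_empty j)
    · rintro rfl; simp

lemma isKernelOn_id (F : Finset (Fin n)) :
    IsKernelOn F fun x y : Fin n → Bool => if y = x then (1 : ℝ) else 0 where
  nonneg x y := by split_ifs <;> norm_num
  sum_eq_one x := by simp
  eq_of_ne_zero x y h j _ := by
    rw [ite_ne_right_iff] at h
    rw [h.1]

lemma card_mul_card_filter_and {F : Finset (Fin n)} {i j : Fin n} (hi : i ∈ F) (hj : j ∈ F)
    (s : Bool) (z : Fin n → Bool) :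
    (F.card : ℝ) * (F.card - 1) * ((freeSlice F z).filter fun x => x i = s ∧ x j = s).card =
      (freeSlice F z).card * ((level F s z).card * ((level F s z).card - 1) +
        if i = j then ((level F s z).card : ℝ) * (F.card - (level F s z).card) else 0) := by
  have h1 : (F.card : ℝ) * ((freeSlice F z).filter fun y => y i = s).card =
      (freeSlice F z).card * (level F s z).card := by exact_mod_cast card_filter_freeSlice hi s z
  by_cases hij : i = j
  · subst hij
    rw [if_pos rfl]
    simp only [and_self]
    linear_combination (F.card - 1 : ℝ) * h1
  rw [if_neg hij, add_zero]
  have hm : (F.card : ℝ) ≠ 0 := by exact_mod_cast (card_pos.2 ⟨i, hi⟩).ne'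
  rcases ((freeSlice F z).filter fun y => y i = s).eq_empty_or_nonempty with h0 | ⟨w, hw⟩
  · have h2 : ((freeSlice F z).filter fun x => x i = s ∧ x j = s) = ∅ := by
      rw [filter_and, h0, empty_inter]
    rw [h0, card_empty, Nat.cast_zero, mul_zero] at h1
    rw [h2, card_empty, Nat.cast_zero, mul_zero, ← mul_assoc, ← h1, zero_mul]
  · obtain ⟨hwC, rfl⟩ := mem_filter.1 hw
    have hC := freeSlice_congr hwC
    have h2 := filter_freeSlice_self hi w
    rw [hC] at h2
    have hj' : j ∈ F.erase i := mem_erase.2 ⟨Ne.symm hij, hj⟩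
    have h3 := card_filter_freeSlice hj' (w i) w
    rw [← h2, filter_filter, card_erase_of_mem hi] at h3
    have h4 : (level (F.erase i) (w i) w).card = (level F (w i) w).card - 1 := by
      rw [level, filter_erase, card_erase_of_mem (by simp [hi])]
      rfl
    have h5 : 1 ≤ (level F (w i) w).card := by
      have := card_level_pos hi w
      exact_mod_cast this
    have h6 : 1 ≤ F.card := card_pos.2 ⟨i, hi⟩
    rw [h4, card_level_congr _ hwC] at h3
    rw [card_level_congr _ hwC] at h5
    have h7 := congrArg (Nat.cast (R := ℝ)) h3
    push_cast [Nat.cast_sub h5, Nat.cast_sub h6] at h7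
    linear_combination (F.card : ℝ) * h7 + ((level F (w i) z).card - 1 : ℝ) * h1

lemma card_mul_sum_sum_level (F : Finset (Fin n)) (s : Bool) (z : Fin n → Bool)
    (u : Fin n → ℝ) :
    (F.card : ℝ) * ∑ x ∈ freeSlice F z, ∑ i ∈ level F s x, u i =
      (freeSlice F z).card * (level F s z).card * ∑ i ∈ F, u i := by
  simp only [level, sum_filter]
  rw [sum_comm, mul_sum, mul_sum]
  refine sum_congr rfl fun i hi => ?_
  rw [← sum_filter, sum_const, nsmul_eq_mul, ← mul_assoc]
  congr 1
  exact_mod_cast card_filter_freeSlice hi s z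

lemma card_mul_sum_sq_sum_level (F : Finset (Fin n)) (s : Bool) (z : Fin n → Bool)
    (u : Fin n → ℝ) :
    (F.card : ℝ) * (F.card - 1) * ∑ x ∈ freeSlice F z, (∑ i ∈ level F s x, u i) ^ 2 =
      (freeSlice F z).card *
        ((level F s z).card * (F.card - (level F s z).card) * ∑ i ∈ F, u i ^ 2 +
          (level F s z).card * ((level F s z).card - 1) * (∑ i ∈ F, u i) ^ 2) := by
  have h1 : ∀ x, (∑ i ∈ level F s x, u i) ^ 2 =
      ∑ i ∈ F, ∑ j ∈ F, if x i = s ∧ x j = s then u i * u j else 0 := by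
    intro x
    rw [level, sum_filter, sq, sum_mul_sum]
    refine sum_congr rfl fun i _ => sum_congr rfl fun j _ => ?_
    by_cases hi : x i = s <;> by_cases hj : x j = s <;> simp [hi, hj]
  have h2 : ∑ x ∈ freeSlice F z, (∑ i ∈ level F s x, u i) ^ 2 = ∑ i ∈ F, ∑ j ∈ F,
      ((freeSlice F z).filter fun x => x i = s ∧ x j = s).card * (u i * u j) := by
    rw [sum_congr rfl fun x _ => h1 x, sum_comm]
    refine sum_congr rfl fun i _ => ?_
    rw [sum_comm]
    refine sum_congr rfl fun j _ => ?_
    rw [← sum_filter, sum_const, nsmul_eq_mul]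
  rw [h2, mul_sum]
  have h3 : ∀ i ∈ F, (F.card : ℝ) * (F.card - 1) * ∑ j ∈ F,
      ((freeSlice F z).filter fun x => x i = s ∧ x j = s).card * (u i * u j) =
      (freeSlice F z).card * ((level F s z).card * (F.card - (level F s z).card) * u i ^ 2 +
        (level F s z).card * ((level F s z).card - 1) * (u i * ∑ j ∈ F, u j)) := by
    intro i hi
    rw [mul_sum, sum_congr rfl fun j hj => by
      rw [← mul_assoc, card_mul_card_filter_and hi hj s z, mul_assoc, add_mul, ite_mul, zero_mul],
      ← mul_sum, sum_add_distrib, sum_ite_eq, if_pos hi, ← mul_sum, ← mul_sum]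
    ring
  rw [sum_congr rfl h3, ← mul_sum, sum_add_distrib, ← mul_sum, ← mul_sum, ← sum_mul]
  ring

lemma sum_level_add_sum_level (F : Finset (Fin n)) (x : Fin n → Bool) (φ : Fin n → ℝ) :
    ∑ j ∈ level F true x, φ j + ∑ j ∈ level F false x, φ j = ∑ j ∈ F, φ j := by
  rw [level, level, ← sum_filter_add_sum_filter_not F fun j => x j = true]
  congr 2
  ext j
  simp

/-- Averages over a free slice of the squares of the two ways in which independent exchanges
displace the coordinates. -/
lemma sum_freeSlice_sum_sq_opp_le {F : Finset (Fin n)} (hF : 2 ≤ F.card) (z : Fin n → Bool)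
    (u : Bool → Fin n → ℝ)
    (hu : (level F true z).card ≠ 0 → (level F false z).card ≠ 0 →
      ((level F false z).card : ℝ) * ∑ i ∈ F, u false i =
        (level F true z).card * ∑ i ∈ F, u true i) :
    ∑ x ∈ freeSlice F z, ∑ j ∈ F, (∑ i ∈ opp F j x, u (x i) i / (opp F i x).card) ^ 2 ≤
      ∑ x ∈ freeSlice F z, ∑ j ∈ F, u (x j) j ^ 2 := by
  have hV : ∀ x ∈ freeSlice F z, ∀ s, ∀ j ∈ level F s x,
      ∑ i ∈ opp F j x, u (x i) i / (opp F i x).card =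
        (∑ i ∈ level F (!s) x, u (!s) i) / (level F s z).card := by
    intro x hx s j hj
    rw [opp, (mem_filter.1 hj).2, sum_div]
    refine sum_congr rfl fun i hi => ?_
    rw [opp, (mem_filter.1 hi).2, Bool.not_not, card_level_congr s hx]
  have hL : ∀ x ∈ freeSlice F z,
      ∑ j ∈ F, (∑ i ∈ opp F j x, u (x i) i / (opp F i x).card) ^ 2 =
        (∑ i ∈ level F false x, u false i) ^ 2 / (level F true z).card +
          (∑ i ∈ level F true x, u true i) ^ 2 / (level F false z).card := by
    intro x hx
    rw [← sum_level_add_sum_level F x,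
      sum_congr rfl fun j hj => congrArg (· ^ 2) (hV x hx true j hj),
      sum_congr (s₁ := level F false x) rfl fun j hj => congrArg (· ^ 2) (hV x hx false j hj),
      sum_const, sum_const, nsmul_eq_mul, nsmul_eq_mul, card_level_congr _ hx, card_level_congr _ hx,
      Bool.not_true, Bool.not_false]
    congr 1
    · by_cases h : ((level F true z).card : ℝ) = 0
      · rw [h]; simp
      · field_simp
    · by_cases h : ((level F false z).card : ℝ) = 0
      · rw [h]; simp
      · field_simp
  have hR : ∀ x, ∑ j ∈ F, u (x j) j ^ 2 =
      ∑ j ∈ level F true x, u true j ^ 2 + ∑ j ∈ level F false x, u false j ^ 2 := by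
    intro x
    rw [← sum_level_add_sum_level F x]
    congr 1 <;> exact sum_congr rfl fun j hj => by rw [(mem_filter.1 hj).2]
  by_cases hk : (level F true z).card = 0
  · refine le_trans (le_of_eq ?_) (sum_nonneg fun x _ => sum_nonneg fun j _ => sq_nonneg _)
    refine sum_eq_zero fun x hx => ?_
    have h0 : level F true x = ∅ := by rw [← card_eq_zero, card_level_congr _ hx, hk]
    rw [hL x hx, hk, h0]
    simp
  by_cases hl : (level F false z).card = 0
  · refine le_trans (le_of_eq ?_) (sum_nonneg fun x _ => sum_nonneg fun j _ => sq_nonneg _)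
    refine sum_eq_zero fun x hx => ?_
    have h0 : level F false x = ∅ := by rw [← card_eq_zero, card_level_congr _ hx, hl]
    rw [hL x hx, hl, h0]
    simp
  have hu' := hu hk hl
  rw [sum_congr rfl hL, sum_congr rfl fun x _ => hR x, sum_add_distrib, sum_add_distrib,
    ← sum_div, ← sum_div]
  have hX1 := card_mul_sum_sq_sum_level F true z (u true)
  have hX0 := card_mul_sum_sq_sum_level F false z (u false)
  have hR1 := card_mul_sum_sum_level F true z fun i => u true i ^ 2
  have hR0 := card_mul_sum_sum_level F false z fun i => u false i ^ 2
  have hS1 := sq_sum_le_card_mul_sum_sq (s := F) (f := u true)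
  have hS0 := sq_sum_le_card_mul_sum_sq (s := F) (f := u false)
  have hm : ((level F true z).card : ℝ) + (level F false z).card = F.card := by
    exact_mod_cast card_level_add F true z
  have hF' : (2 : ℝ) ≤ F.card := by exact_mod_cast hF
  have hk' : (0 : ℝ) < (level F true z).card := by exact_mod_cast Nat.pos_of_ne_zero hk
  have hl' : (0 : ℝ) < (level F false z).card := by exact_mod_cast Nat.pos_of_ne_zero hl
  have hN := freeSlice_card_pos F z
  generalize ((level F true z).card : ℝ) = k at *
  generalize ((level F false z).card : ℝ) = l at *
  generalize ((freeSlice F z).card : ℝ) = N at *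
  generalize (F.card : ℝ) = m at *
  generalize ∑ x ∈ freeSlice F z, (∑ i ∈ level F true x, u true i) ^ 2 = X1 at *
  generalize ∑ x ∈ freeSlice F z, (∑ i ∈ level F false x, u false i) ^ 2 = X0 at *
  generalize ∑ x ∈ freeSlice F z, ∑ i ∈ level F true x, u true i ^ 2 = R1 at *
  generalize ∑ x ∈ freeSlice F z, ∑ i ∈ level F false x, u false i ^ 2 = R0 at *
  generalize ∑ i ∈ F, u true i ^ 2 = A1 at *
  generalize ∑ i ∈ F, u false i ^ 2 = A0 at *
  generalize ∑ i ∈ F, u true i = S1 at *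
  generalize ∑ i ∈ F, u false i = S0 at *
  obtain rfl : S0 = k / l * S1 := by field_simp; linarith
  have hm0 : 0 < m := by linarith
  have hM : 0 < m * (m - 1) := mul_pos hm0 (by linarith)
  refine le_of_mul_le_mul_left ?_ hM
  have e1 : m * (m - 1) * (X0 / k + X1 / l) =
      N * (k * A1 + l * A0 + (m - 2) * (k / l * S1 ^ 2)) := by
    have : m * (m - 1) * (X0 / k + X1 / l) =
        (m * (m - 1) * X0) / k + (m * (m - 1) * X1) / l := by ring
    rw [this, hX0, hX1, ← hm]
    field_simp
    ring
  have e2 : m * (m - 1) * (R1 + R0) = N * ((m - 1) * (k * A1 + l * A0)) := by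
    linear_combination (m - 1) * (hR1 + hR0)
  have e3 : k / l * S1 ^ 2 ≤ k * A1 + l * A0 := by
    have h1 := mul_le_mul_of_nonneg_left hS1 hk'.le
    have h2 := mul_le_mul_of_nonneg_left hS0 hl'.le
    have h3 : k * S1 ^ 2 + l * (k / l * S1) ^ 2 = m * (k / l * S1 ^ 2) := by
      rw [← hm]; field_simp; ring
    refine le_of_mul_le_mul_left ?_ hm0
    rw [← h3]
    linarith
  rw [e1, e2]
  refine mul_le_mul_of_nonneg_left ?_ hN.le
  nlinarith [mul_le_mul_of_nonneg_left e3 (by linarith : 0 ≤ m - 2)]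

/-- The average of `ν` over the points of the free slice of `z` with value `s` at `i`. -/
def condAvg (F : Finset (Fin n)) (ν : (Fin n → Bool) → ℝ) (z : Fin n → Bool) (s : Bool)
    (i : Fin n) : ℝ :=
  (∑ y ∈ (freeSlice F z).filter fun y => y i = s, ν y) /
    ((freeSlice F z).filter fun y => y i = s).card

section CondAvg

variable {F : Finset (Fin n)} {i : Fin n}

lemma sliceAvg_erase_eq_condAvg (hi : i ∈ F) (ν : (Fin n → Bool) → ℝ) {x z : Fin n → Bool}
    (hx : x ∈ freeSlice F z) : sliceAvg (F.erase i) ν x = condAvg F ν z (x i) i := by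
  rw [condAvg, ← freeSlice_congr hx, filter_freeSlice_self hi, sliceAvg]

lemma card_mul_level_mul_condAvg (hi : i ∈ F) (ν : (Fin n → Bool) → ℝ) (z : Fin n → Bool)
    (s : Bool) :
    (freeSlice F z).card * ((level F s z).card * condAvg F ν z s i) =
      F.card * ∑ y ∈ (freeSlice F z).filter fun y => y i = s, ν y := by
  have h1 : (F.card : ℝ) * ((freeSlice F z).filter fun y => y i = s).card =
      (freeSlice F z).card * (level F s z).card := by exact_mod_cast card_filter_freeSlice hi s z
  rw [← mul_assoc, ← h1, condAvg]
  rcases ((freeSlice F z).filter fun y => y i = s).eq_empty_or_nonempty with h0 | h0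
  · rw [h0]; simp
  · have : (((freeSlice F z).filter fun y => y i = s).card : ℝ) ≠ 0 := by
      exact_mod_cast h0.card_pos.ne'
    field_simp

lemma level_mul_condAvg_sub (hi : i ∈ F) (ν : (Fin n → Bool) → ℝ) (z : Fin n → Bool) :
    (level F true z).card * (condAvg F ν z true i - sliceAvg F ν z) =
      (level F false z).card * (sliceAvg F ν z - condAvg F ν z false i) := by
  have h1 := card_mul_level_mul_condAvg hi ν z true
  have h0 := card_mul_level_mul_condAvg hi ν z false
  have h2 := card_mul_sliceAvg F ν z
  rw [← sum_filter_add_sum_filter_not _ fun y => y i = true] at h2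
  simp only [Bool.not_eq_true] at h2
  have hm : ((level F true z).card : ℝ) + (level F false z).card = F.card := by
    exact_mod_cast card_level_add F true z
  refine mul_left_cancel₀ (freeSlice_card_pos F z).ne' ?_
  rw [← hm] at h1 h0
  linear_combination h1 + h0 - ((level F true z).card + (level F false z).card : ℝ) * h2

lemma sum_condAvg_sub (ν : (Fin n → Bool) → ℝ) {z : Fin n → Bool} {s : Bool}
    (h : (level F s z).card ≠ 0) : ∑ i ∈ F, (condAvg F ν z s i - sliceAvg F ν z) = 0 := by
  have h1 : ∑ i ∈ F, (freeSlice F z).card * ((level F s z).card * condAvg F ν z s i) =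
      F.card * ((level F s z).card * ∑ y ∈ freeSlice F z, ν y) := by
    rw [sum_congr rfl fun i hi => card_mul_level_mul_condAvg hi ν z s, ← mul_sum]
    congr 1
    simp only [sum_filter]
    rw [sum_comm, mul_sum]
    refine sum_congr rfl fun y hy => ?_
    rw [← sum_filter, sum_const, nsmul_eq_mul]
    congr 2
    exact card_level_congr s hy
  rw [← card_mul_sliceAvg, ← mul_sum, ← mul_sum] at h1
  have h' : ((level F s z).card : ℝ) ≠ 0 := by exact_mod_cast h
  refine mul_left_cancel₀ (mul_ne_zero (freeSlice_card_pos F z).ne' h') ?_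
  rw [sum_sub_distrib, sum_const, nsmul_eq_mul]
  linear_combination h1

end CondAvg

lemma sum_sliceAvg_mul_opp_shapeProb_le {F : Finset (Fin n)} (hF : 2 ≤ F.card)
    {ν : (Fin n → Bool) → ℝ} (hν : ∀ x, 0 ≤ ν x) :
    ∑ x, sliceAvg F ν x * ∑ j ∈ F, (∑ i ∈ opp F j x, shapeProb F ν i x / (opp F i x).card) ^ 2 ≤
      ∑ x, sliceAvg F ν x * ∑ j ∈ F, shapeProb F ν j x ^ 2 := by
  refine sum_le_sum_of_freeSlice F _ _ fun z => ?_
  have hf := sliceAvg_nonneg F hν z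
  set u : Bool → Fin n → ℝ := fun s i =>
    max (sliceAvg F ν z - condAvg F ν z s i) 0 / sliceAvg F ν z with hu
  have hb : ∀ x ∈ freeSlice F z, ∀ i ∈ F, shapeProb F ν i x = u (x i) i := by
    intro x hx i hi
    rw [shapeProb, sliceAvg_erase_eq_condAvg hi ν hx, sliceAvg_congr ν hx]
  have h1 := sum_freeSlice_sum_sq_opp_le hF z u ?_
  · have hc : ∀ φ : (Fin n → Bool) → ℝ, ∑ x ∈ freeSlice F z, sliceAvg F ν x * φ x =
        sliceAvg F ν z * ∑ x ∈ freeSlice F z, φ x := fun φ => by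
      rw [mul_sum]
      exact sum_congr rfl fun x hx => by rw [sliceAvg_congr ν hx]
    rw [hc, hc]
    refine mul_le_mul_of_nonneg_left (le_trans (le_of_eq ?_) (h1.trans (le_of_eq ?_))) hf
    · refine sum_congr rfl fun x hx => sum_congr rfl fun j hj => ?_
      rw [sum_congr rfl fun i hi => by rw [hb x hx i (mem_opp.1 hi).1]]
    · refine sum_congr rfl fun x hx => sum_congr rfl fun j hj => ?_
      rw [hb x hx j hj]
  · intro hk hl
    have hkpos : (0 : ℝ) ≤ (level F true z).card := Nat.cast_nonneg _
    have hlpos : (0 : ℝ) ≤ (level F false z).card := Nat.cast_nonneg _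
    have h2 : ∀ i ∈ F, (level F false z).card * u false i =
        (level F true z).card * (max (condAvg F ν z true i - sliceAvg F ν z) 0 /
          sliceAvg F ν z) := by
      intro i hi
      rw [hu]
      simp only
      rw [mul_div_assoc', mul_div_assoc', mul_max_of_nonneg _ _ hlpos,
        mul_max_of_nonneg _ _ hkpos, level_mul_condAvg_sub hi, mul_zero, mul_zero]
    rw [mul_sum, sum_congr rfl h2, ← mul_sum, ← sum_div, ← sum_div]
    congr 2
    rw [← sub_eq_zero, ← sum_sub_distrib]
    refine (sum_congr rfl fun i _ => ?_).trans (sum_condAvg_sub ν hk)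
    rcases le_total (sliceAvg F ν z) (condAvg F ν z true i) with h | h
    · rw [max_eq_left (by linarith), max_eq_right (by linarith)]; ring
    · rw [max_eq_right (by linarith), max_eq_left (by linarith)]; ring

lemma sum_shapeProb_sq_le {F : Finset (Fin n)} (hF : 2 ≤ F.card) {ν : (Fin n → Bool) → ℝ}
    (hν : ∀ x, 0 ≤ ν x) :
    ∑ x, sliceAvg F ν x * ∑ j ∈ F, (shapeProb F ν j x ^ 2 +
      (∑ i ∈ opp F j x, shapeProb F ν i x / (opp F i x).card) ^ 2) ≤
      ∑ i ∈ F, 4 * coordEnt F i ν := by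
  simp only [sum_add_distrib, mul_add]
  have h1 : ∑ x, sliceAvg F ν x * ∑ j ∈ F, shapeProb F ν j x ^ 2 ≤
      ∑ i ∈ F, 2 * coordEnt F i ν := by
    simp only [mul_sum]
    rw [sum_comm]
    refine sum_le_sum fun i hi => ?_
    have h2 : ∀ x, sliceAvg F ν x * shapeProb F ν i x ^ 2 =
        max (sliceAvg F ν x - sliceAvg (F.erase i) ν x) 0 ^ 2 / sliceAvg F ν x := by
      intro x
      rw [sq, ← mul_assoc, mul_shapeProb hν, shapeProb]
      ring
    simp only [h2]
    have h3 := sum_nonneg fun x (_ : x ∈ univ) => div_nonneg (sq_nonneg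
      (max (sliceAvg (F.erase i) ν x - sliceAvg F ν x) 0)) (sliceAvg_nonneg (F.erase i) hν x)
    linarith [sum_posPart_sq_le_coordEnt hi hν]
  have h2 := sum_sliceAvg_mul_opp_shapeProb_le hF hν
  rw [← mul_sum] at h1 ⊢
  linarith

/-- The induction step: mixing exchanges followed by kernels on one coordinate fewer. -/
lemma exists_kernel_of_erase {F : Finset (Fin n)} (hF : 2 ≤ F.card)
    {a : Fin n → (Fin n → Bool) → ℝ} (ha0 : ∀ i x, 0 ≤ a i x) (ha1 : ∀ i x, a i x ≤ 1)
    (hopp : ∀ i ∈ F, ∀ x, opp F i x = ∅ → a i x = 0) {σ τ : (Fin n → Bool) → ℝ}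
    (hσ : ∀ x, 0 ≤ σ x) {H : ℝ} {c : Fin n → ℝ}
    (hsum : ∑ x, σ x * ∑ j ∈ F,
      (a j x ^ 2 + (∑ i ∈ opp F j x, a i x / (opp F i x).card) ^ 2) ≤ ∑ i ∈ F, 4 * c i)
    (hR : ∀ i ∈ F, ∃ R, IsKernelOn (F.erase i) R ∧
      (∀ y, push (push σ (exchKernel F i (a i))) R y = τ y) ∧
      kernelCost (push σ (exchKernel F i (a i))) R ≤ 8 * (H - c i)) :
    ∃ p, IsKernelOn F p ∧ (∀ y, push σ p y = τ y) ∧ kernelCost σ p ≤ 8 * H := by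
  choose! R hR1 hR2 hR3 using hR
  have hF0 : F.Nonempty := card_pos.1 (by omega)
  have hm : (0 : ℝ) < F.card := by exact_mod_cast hF0.card_pos
  refine ⟨mixKernel F a R, isKernelOn_mixKernel hF0 ha0 ha1 hopp hR1, fun y => ?_, ?_⟩
  · rw [push_mixKernel, sum_congr rfl fun i hi => hR2 i hi y, sum_const, nsmul_eq_mul,
      mul_div_cancel_left₀ _ hm.ne']
  · refine (kernelCost_mixKernel_le hF ha0 ha1 hopp hR1 hσ).trans ?_
    rw [div_le_iff₀ hm]
    have h1 := sum_le_sum hR3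
    rw [← mul_sum, sum_sub_distrib, sum_const, nsmul_eq_mul] at h1
    rw [← mul_sum] at hsum
    linarith

lemma sliceAvg_of_card_le_one {F : Finset (Fin n)} (hF : F.card ≤ 1) (ν : (Fin n → Bool) → ℝ) :
    sliceAvg F ν = ν := by
  ext x
  rw [sliceAvg, freeSlice_of_card_le_one hF]
  simp

lemma exists_kernel_of_card_le_one {F : Finset (Fin n)} (hF : F.card ≤ 1)
    (ν : (Fin n → Bool) → ℝ) :
    ∃ p, IsKernelOn F p ∧ (∀ y, push ν p y = ν y) ∧ kernelCost ν p ≤ 8 * sliceEnt F ν := by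
  refine ⟨_, isKernelOn_id F, fun y => by simp [push], ?_⟩
  have h1 : sliceEnt F ν = 0 := by
    rw [sliceEnt, sliceAvg_of_card_le_one hF]
    refine sum_eq_zero fun x _ => ?_
    by_cases h : ν x = 0
    · simp [h]
    · simp [div_self h]
  rw [h1, kernelCost]
  simp [(isKernelOn_id ∅).disp_eq_zero]

/-- Transport of a measure to its average over free slices. -/
lemma exists_kernel_to_sliceAvg (F : Finset (Fin n)) (ν : (Fin n → Bool) → ℝ)
    (hν : ∀ x, 0 ≤ ν x) :
    ∃ p, IsKernelOn F p ∧ (∀ y, push ν p y = sliceAvg F ν y) ∧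
      kernelCost ν p ≤ 8 * sliceEnt F ν := by
  induction hm : F.card generalizing F ν with
  | zero =>
    rw [sliceAvg_of_card_le_one (by omega)]
    exact exists_kernel_of_card_le_one (by omega) ν
  | succ m ih =>
    rcases Nat.eq_zero_or_pos m with h0 | h0
    · rw [sliceAvg_of_card_le_one (by omega)]
      exact exists_kernel_of_card_le_one (by omega) ν
    refine exists_kernel_of_erase (by omega) (a := flattenProb F ν) (c := fun i => coordEnt F i ν)
      (flattenProb_nonneg hν) (flattenProb_le_one hν)
      (fun i hi x => flattenProb_of_opp_eq_empty hi) hν ?_ fun i hi => ?_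
    · refine (sum_flattenProb_sq_le hν).trans (sum_le_sum fun i hi => ?_)
      linarith [coordEnt_nonneg hi hν]
    · have hK := isKernelOn_exchKernel hi (flattenProb_nonneg (F := F) hν i)
        (flattenProb_le_one hν i) fun x => flattenProb_of_opp_eq_empty hi
      obtain ⟨R, hR1, hR2, hR3⟩ := ih (F.erase i) _ (push_nonneg hν hK.nonneg)
        (by rw [card_erase_of_mem hi]; omega)
      refine ⟨R, hR1, fun y => by rw [hR2, sliceAvg_erase_push_flatten hi hν], hR3.trans ?_⟩
      have h1 := sliceEnt_erase_push_flatten_le hi hν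
      have h2 := sliceEnt_eq_add_coordEnt hi hν
      linarith

/-- Transport of the average over free slices to the original measure. -/
lemma exists_kernel_from_sliceAvg (F : Finset (Fin n)) (ν : (Fin n → Bool) → ℝ)
    (hν : ∀ x, 0 ≤ ν x) :
    ∃ p, IsKernelOn F p ∧ (∀ y, push (sliceAvg F ν) p y = ν y) ∧
      kernelCost (sliceAvg F ν) p ≤ 8 * sliceEnt F ν := by
  induction hm : F.card generalizing F with
  | zero =>
    rw [sliceAvg_of_card_le_one (by omega)]
    exact exists_kernel_of_card_le_one (by omega) ν
  | succ m ih =>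
    rcases Nat.eq_zero_or_pos m with h0 | h0
    · rw [sliceAvg_of_card_le_one (by omega)]
      exact exists_kernel_of_card_le_one (by omega) ν
    refine exists_kernel_of_erase (by omega) (a := shapeProb F ν) (c := fun i => coordEnt F i ν)
      (shapeProb_nonneg hν) (shapeProb_le_one hν)
      (fun i hi x => shapeProb_of_opp_eq_empty hi) (sliceAvg_nonneg F hν)
      (sum_shapeProb_sq_le (by omega) hν) fun i hi => ?_
    obtain ⟨R, hR1, hR2, hR3⟩ := ih (F.erase i) (by rw [card_erase_of_mem hi]; omega)
    rw [funext (push_shape hi hν)]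
    refine ⟨R, hR1, hR2, hR3.trans ?_⟩
    linarith [sliceEnt_eq_add_coordEnt hi hν]

lemma sliceEnt_nonneg (F : Finset (Fin n)) {ν : (Fin n → Bool) → ℝ} (hν : ∀ x, 0 ≤ ν x) :
    0 ≤ sliceEnt F ν := by
  obtain ⟨p, -, -, hp⟩ := exists_kernel_to_sliceAvg F ν hν
  linarith [kernelCost_nonneg hν p]

lemma kernelCost_kernelComp_le {F G : Finset (Fin n)}
    {p q : (Fin n → Bool) → (Fin n → Bool) → ℝ} (hp : IsKernelOn F p) (hq : IsKernelOn G q)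
    {σ : (Fin n → Bool) → ℝ} (hσ : ∀ x, 0 ≤ σ x) :
    kernelCost σ (kernelComp p q) ≤
      (√(kernelCost σ p) + √(kernelCost (push σ p) q)) ^ 2 := by
  set w : (Fin n → Bool) → Fin n → ℝ := fun x j => ∑ z, p x z * disp q z j with hw
  have hw0 : ∀ x j, 0 ≤ w x j := fun x j =>
    sum_nonneg fun z _ => mul_nonneg (hp.nonneg x z) (disp_nonneg hq.nonneg z j)
  have h1 : kernelCost σ (kernelComp p q) ≤ kernelCost σ p +
      2 * ∑ x, σ x * ∑ j, disp p x j * w x j + ∑ x, σ x * ∑ j, w x j ^ 2 := by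
    rw [kernelCost, kernelCost, mul_sum, ← sum_add_distrib, ← sum_add_distrib]
    refine sum_le_sum fun x _ => ?_
    have : ∀ j, disp (kernelComp p q) x j ^ 2 ≤
        disp p x j ^ 2 + 2 * (disp p x j * w x j) + w x j ^ 2 := by
      intro j
      have hpq : ∀ x y, 0 ≤ kernelComp p q x y := fun x y =>
        sum_nonneg fun z _ => mul_nonneg (hp.nonneg x z) (hq.nonneg z y)
      refine (pow_le_pow_left₀ (disp_nonneg hpq x j) (disp_kernelComp_le hp hq x j) 2).trans
        (le_of_eq ?_)
      simp only [hw]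
      ring
    refine (mul_le_mul_of_nonneg_left (sum_le_sum fun j _ => this j) (hσ x)).trans (le_of_eq ?_)
    rw [sum_add_distrib, sum_add_distrib, ← mul_sum]
    ring
  have h2 : ∑ x, σ x * ∑ j, w x j ^ 2 ≤ kernelCost (push σ p) q := by
    rw [kernelCost, sum_push_mul]
    refine sum_le_sum fun x _ => mul_le_mul_of_nonneg_left ?_ (hσ x)
    simp only [mul_sum]
    rw [sum_comm]
    exact sum_le_sum fun j _ => sq_sum_mul_le (p x) (fun z => disp q z j) (hp.nonneg x)
      (hp.sum_eq_one x)
  have h3 : ∑ x, σ x * ∑ j, disp p x j * w x j ≤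
      √(kernelCost σ p) * √(∑ x, σ x * ∑ j, w x j ^ 2) := by
    rw [← Real.sqrt_mul (kernelCost_nonneg hσ p)]
    refine Real.le_sqrt_of_sq_le ?_
    have := sum_mul_sq_le_sq_mul_sq univ (fun xj : (Fin n → Bool) × Fin n =>
      √(σ xj.1) * disp p xj.1 xj.2) fun xj => √(σ xj.1) * w xj.1 xj.2
    simp only [Fintype.sum_prod_type, mul_pow, Real.sq_sqrt (hσ _), ← mul_sum] at this
    refine le_trans (le_of_eq ?_) this
    congr 1
    refine sum_congr rfl fun x _ => ?_
    rw [mul_sum]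
    refine sum_congr rfl fun j _ => ?_
    rw [mul_mul_mul_comm, Real.mul_self_sqrt (hσ x)]
  have h4 := mul_le_mul_of_nonneg_left (Real.sqrt_le_sqrt h2) (Real.sqrt_nonneg (kernelCost σ p))
  have h5 := Real.sq_sqrt (kernelCost_nonneg hσ p)
  have h6 := Real.sq_sqrt (kernelCost_nonneg (push_nonneg hσ hp.nonneg) q)
  nlinarith

lemma mem_freeSlice_univ {x y : Fin n → Bool} : y ∈ freeSlice univ x ↔
    (univ.filter fun i => y i = true).card = (univ.filter fun i => x i = true).card := by
  simp [mem_freeSlice]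

lemma card_freeSlice_univ {k : ℕ} {x : Fin n → Bool} (hx : x ∈ cubeSlice n k) :
    (freeSlice univ x).card = n.choose k := by
  have hx' : (univ.filter fun i => x i = true).card = k := hx
  have hc := card_powersetCard k (univ : Finset (Fin n))
  rw [card_univ, Fintype.card_fin] at hc
  rw [← hc]
  refine card_nbij' (fun y => univ.filter fun i => y i = true) (fun s i => decide (i ∈ s))
    ?_ ?_ ?_ ?_
  · intro y hy
    simp only [mem_coe, mem_freeSlice_univ, hx'] at hy
    simp [mem_powersetCard, hy]
  · intro s hs
    simp only [mem_coe, mem_powersetCard] at hs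
    simp [mem_freeSlice_univ, hx', hs.2]
  · intro y _
    ext i
    simp
  · intro s _
    ext i
    simp

lemma sliceAvg_univ {k : ℕ} {ν : (Fin n → Bool) → ℝ} (hν : IsProbOn ν (cubeSlice n k)) :
    sliceAvg univ ν = unifSlice n k := by
  ext x
  rw [sliceAvg, unifSlice]
  split_ifs with hx
  · rw [card_freeSlice_univ hx, ← one_div, ← hν.2.2]
    congr 1
    refine sum_subset (subset_univ _) fun y _ hy => hν.2.1 y fun hy' => hy ?_
    rw [mem_freeSlice_univ]
    exact Eq.trans hy' (Eq.symm hx)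
  · rw [sum_eq_zero, zero_div]
    intro y hy
    refine hν.2.1 y fun hy' => hx ?_
    exact (mem_freeSlice_univ.1 hy).symm.trans hy'

lemma relEnt_unifSlice {k : ℕ} (hk : k ≤ n) {ν : (Fin n → Bool) → ℝ}
    (hν : IsProbOn ν (cubeSlice n k)) :
    relEnt ν (unifSlice n k) = ENNReal.ofReal (sliceEnt univ ν) := by
  rw [relEnt, if_pos, sliceEnt, sliceAvg_univ hν]
  intro x hx
  refine hν.2.1 x fun hx' => ?_
  rw [unifSlice, if_pos hx', inv_eq_zero, Nat.cast_eq_zero] at hx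
  exact (Nat.choose_pos hk).ne' hx

lemma hatT2_le {ν₁ ν₂ : (Fin n → Bool) → ℝ} {k : ℕ} (hν₁ : IsProbOn ν₁ (cubeSlice n k))
    (hν₂ : IsProbOn ν₂ (cubeSlice n k)) :
    hatT2 ν₁ ν₂ ≤ 8 * (√(sliceEnt univ ν₁) + √(sliceEnt univ ν₂)) ^ 2 := by
  obtain ⟨p, hp, hpp, hpc⟩ := exists_kernel_to_sliceAvg univ ν₁ hν₁.1
  obtain ⟨q, hq, hqp, hqc⟩ := exists_kernel_from_sliceAvg univ ν₂ hν₂.1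
  have hpq := hp.comp hq subset_rfl
  have havg : push ν₁ p = sliceAvg univ ν₂ := by
    rw [sliceAvg_univ hν₂, ← sliceAvg_univ hν₁]
    exact funext hpp
  have h1 : hatT2 ν₁ ν₂ ≤ kernelCost ν₁ (kernelComp p q) := by
    refine csInf_le ⟨0, ?_⟩ ⟨kernelComp p q, hpq.nonneg, hpq.sum_eq_one, fun y => ?_, rfl⟩
    · rintro _ ⟨r, -, -, -, rfl⟩
      exact kernelCost_nonneg hν₁.1 r
    · exact (push_kernelComp ν₁ p q y).trans (by rw [havg, hqp])
  refine h1.trans ((kernelCost_kernelComp_le hp hq hν₁.1).trans ?_)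
  rw [havg]
  have h2 := (Real.sqrt_le_sqrt hpc).trans_eq (Real.sqrt_mul (by norm_num) _)
  have h3 := (Real.sqrt_le_sqrt hqc).trans_eq (Real.sqrt_mul (by norm_num) _)
  refine (pow_le_pow_left₀ (by positivity) (add_le_add h2 h3) 2).trans (le_of_eq ?_)
  rw [← mul_add, mul_pow, Real.sq_sqrt (by norm_num)]

end SliceTransport

/-- Transport-entropy inequality for the weak cost `T̂₂` on the cubeSlice of the
discrete cube. -/
theorem stmt12 {n k : ℕ} (hn : 1 ≤ n) (hk : k ≤ n)
    (ν₁ ν₂ : (Fin n → Bool) → ℝ)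
    (hν₁ : IsProbOn ν₁ (cubeSlice n k)) (hν₂ : IsProbOn ν₂ (cubeSlice n k)) :
    ENNReal.ofReal (hatT2 ν₁ ν₂) ≤
      ENNReal.ofReal 8 *
        (relEnt ν₁ (unifSlice n k) ^ ((1 : ℝ) / 2) +
          relEnt ν₂ (unifSlice n k) ^ ((1 : ℝ) / 2)) ^ 2 := by
  rw [SliceTransport.relEnt_unifSlice hk hν₁, SliceTransport.relEnt_unifSlice hk hν₂,
    ENNReal.ofReal_rpow_of_nonneg (SliceTransport.sliceEnt_nonneg _ hν₁.1) (by norm_num),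
    ENNReal.ofReal_rpow_of_nonneg (SliceTransport.sliceEnt_nonneg _ hν₂.1) (by norm_num),
    ← Real.sqrt_eq_rpow, ← Real.sqrt_eq_rpow,
    ← ENNReal.ofReal_add (Real.sqrt_nonneg _) (Real.sqrt_nonneg _),
    ← ENNReal.ofReal_pow (by positivity), ← ENNReal.ofReal_mul (by norm_num)]
  exact ENNReal.ofReal_le_ofReal (SliceTransport.hatT2_le hν₁ hν₂)

end
end

section
/- Let G be a subgroup of S_n with ℓ-local base T, G ≠ {id}, and let μ ∈ M_T. Let g : G → ℝ and β : G → [0,∞) satisfy g(τ) − g(σ) ≤ β(τ)·d_H(τ,σ) for all σ,τ ∈ G. Then, with c = min(2ℓ−1, n) and μ(g) = ∑_σ g(σ)μ(σ), for all u ≥ 0: μ( g ≥ μ(g) + u ) ≤ exp( −2u² / ( K_n c² · sup_{σ∈G} β(σ)² ) ) and μ( g ≤ μ(g) − u ) ≤ exp( −2u² / ( K_n c² · min( sup_{σ∈G} β(σ)², 4·∑_σ β(σ)²μ(σ) ) ) ). -/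
attribute [local instance] Classical.propDecidable

noncomputable section

/-- Hamming distance on permutations, as a real number. -/
noncomputable def dH {n : ℕ} (σ τ : Equiv.Perm (Fin n)) : ℝ :=
  ((Finset.univ.filter fun i => σ i ≠ τ i).card : ℝ)

/-- Degree (cardinality of the support) of a permutation. -/
noncomputable def degree {n : ℕ} (σ : Equiv.Perm (Fin n)) : ℕ :=
  (Finset.univ.filter fun i => σ i ≠ i).card

/-- The subgroup `G_j` of elements of `G` fixing every index `> j`. -/
def Gj {n : ℕ} (G : Subgroup (Equiv.Perm (Fin n))) (j : Fin n) :
    Set (Equiv.Perm (Fin n)) :=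
  {σ | σ ∈ G ∧ ∀ i : Fin n, j < i → σ i = i}

/-- The orbit `O_j` of `j` under `G_j`. -/
def Orb {n : ℕ} (G : Subgroup (Equiv.Perm (Fin n))) (j : Fin n) : Set (Fin n) :=
  {i | ∃ σ ∈ Gj G j, σ j = i}

/-- An `ℓ`-local base of `G`. -/
def IsLocalBase {n : ℕ} (ℓ : ℕ) (G : Subgroup (Equiv.Perm (Fin n)))
    (t : Fin n → Fin n → Equiv.Perm (Fin n)) : Prop :=
  ∀ j : Fin n, (j : ℕ) ≠ 0 →
    t j j = 1 ∧ ∀ i ∈ Orb G j, i ≠ j →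
      t i j ∈ Gj G j ∧ t i j i = j ∧ degree (t i j) ≤ ℓ

/-- The map `U_T (i_2, …, i_n) = t_{i_2,2} t_{i_3,3} ⋯ t_{i_n,n}`. -/
noncomputable def UT {n : ℕ} (t : Fin n → Fin n → Equiv.Perm (Fin n))
    (i : Fin n → Fin n) : Equiv.Perm (Fin n) :=
  (((List.finRange n).drop 1).map fun j => t (i j) j).prod

/-- `μ` belongs to the class `M_T`: it is the pushforward under `U_T` of a product
of probability measures on the orbits `O_j`. -/
def MemMT {n : ℕ} (G : Subgroup (Equiv.Perm (Fin n)))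
    (t : Fin n → Fin n → Equiv.Perm (Fin n)) (μ : Equiv.Perm (Fin n) → ℝ) : Prop :=
  ∃ νh : Fin n → Fin n → ℝ,
    (∀ j : Fin n,
      (∀ i, 0 ≤ νh j i) ∧ (∀ i, i ∉ Orb G j → νh j i = 0) ∧ ∑ i, νh j i = 1) ∧
    ∀ σ, μ σ = ∑ i : Fin n → Fin n, if UT t i = σ then ∏ j, νh j (i j) else 0

/-- `K_n`, the number of indices `j ∈ {2, …, n}` with `O_j ≠ {j}`. -/
noncomputable def Kn {n : ℕ} (G : Subgroup (Equiv.Perm (Fin n))) : ℕ :=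
  (Finset.univ.filter fun j : Fin n => (j : ℕ) ≠ 0 ∧ Orb G j ≠ {j}).card

/-- Expectation of `F` under the product of the weights `ν j`. -/
def prodExp {A : Type*} [Fintype A] {n : ℕ} (ν : Fin n → A → ℝ) (F : (Fin n → A) → ℝ) : ℝ :=
  ∑ x, (∏ j, ν j (x j)) * F x

section ProductExpectation

variable {A : Type*} [Fintype A]

theorem prodExp_zero (ν : Fin 0 → A → ℝ) (F : (Fin 0 → A) → ℝ) :
    prodExp ν F = F default := by
  simp [prodExp]

theorem prodExp_succ {n : ℕ} (ν : Fin (n + 1) → A → ℝ) (F : (Fin (n + 1) → A) → ℝ) :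
    prodExp ν F =
      prodExp (fun j => ν j.succ) fun x => ∑ w, ν 0 w * F (Fin.cons w x) := by
  unfold prodExp
  rw [← (Fin.consEquiv fun _ : Fin (n + 1) => A).sum_comp, Fintype.sum_prod_type_right]
  refine Finset.sum_congr rfl fun x _ => ?_
  rw [Finset.mul_sum]
  refine Finset.sum_congr rfl fun w _ => ?_
  change (∏ j, ν j (Fin.cons (α := fun _ => A) w x j)) * F (Fin.cons w x) = _
  simp only [Fin.prod_univ_succ, Fin.cons_zero, Fin.cons_succ]
  ring

variable {n : ℕ} {ν : Fin n → A → ℝ}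

theorem prodExp_mono (hν : ∀ j a, 0 ≤ ν j a) {F H : (Fin n → A) → ℝ} (h : ∀ x, F x ≤ H x) :
    prodExp ν F ≤ prodExp ν H :=
  Finset.sum_le_sum fun x _ =>
    mul_le_mul_of_nonneg_left (h x) (Finset.prod_nonneg fun j _ => hν j _)

theorem prodExp_congr {F H : (Fin n → A) → ℝ}
    (h : ∀ x, (∏ j, ν j (x j)) ≠ 0 → F x = H x) : prodExp ν F = prodExp ν H := by
  refine Finset.sum_congr rfl fun x _ => ?_
  by_cases hx : ∏ j, ν j (x j) = 0
  · simp [hx]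
  · rw [h x hx]

theorem prodExp_add (F H : (Fin n → A) → ℝ) :
    prodExp ν (fun x => F x + H x) = prodExp ν F + prodExp ν H := by
  simp [prodExp, mul_add, Finset.sum_add_distrib]

theorem prodExp_const_mul (c : ℝ) (F : (Fin n → A) → ℝ) :
    prodExp ν (fun x => c * F x) = c * prodExp ν F := by
  simp only [prodExp, Finset.mul_sum]
  exact Finset.sum_congr rfl fun x _ => by ring

theorem prodExp_mul_const (F : (Fin n → A) → ℝ) (c : ℝ) :
    prodExp ν (fun x => F x * c) = prodExp ν F * c := by
  simp only [prodExp, Finset.sum_mul]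
  exact Finset.sum_congr rfl fun x _ => by ring

theorem prodExp_neg (F : (Fin n → A) → ℝ) : prodExp ν (fun x => -F x) = -prodExp ν F := by
  simp [prodExp]

theorem prodExp_one (hν : ∀ j, ∑ a, ν j a = 1) : prodExp ν (fun _ => 1) = 1 := by
  simp only [prodExp, mul_one]
  rw [← Fintype.prod_sum]
  simp [hν]

theorem prodExp_nonneg (hν : ∀ j a, 0 ≤ ν j a) {F : (Fin n → A) → ℝ} (h : ∀ x, 0 ≤ F x) :
    0 ≤ prodExp ν F :=
  Finset.sum_nonneg fun x _ => mul_nonneg (Finset.prod_nonneg fun j _ => hν j _) (h x)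

end ProductExpectation

section MomentBounds

variable {A : Type*} [Fintype A]

theorem exp_neg_le_quadratic {s : ℝ} (hs : 0 ≤ s) : Real.exp (-s) ≤ 1 - s + s ^ 2 / 2 := by
  have h := Real.quadratic_le_exp_of_nonneg hs
  have hpos : 0 < 1 - s + s ^ 2 / 2 := by nlinarith [sq_nonneg (s - 1)]
  rw [Real.exp_neg, inv_le_comm₀ (Real.exp_pos s) hpos, inv_le_iff_one_le_mul₀ hpos]
  nlinarith [sq_nonneg (s ^ 2)]

/-- One-coordinate case of the weak transport inequality, in exponential form. -/
theorem sum_mul_le_exp_of_le_exp {p : A → ℝ} (hp : ∀ a, 0 ≤ p a) (hp1 : ∑ a, p a = 1)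
    {F k a : A → ℝ} (ha : ∀ w, 0 ≤ a w)
    (h : ∀ w z, F z ≤ Real.exp (k w + if w = z then 0 else a w)) :
    ∑ z, p z * F z ≤ Real.exp (∑ w, p w * (k w + a w ^ 2 / 2)) := by
  have hne : (Finset.univ : Finset A).Nonempty := by
    by_contra hc
    rw [Finset.not_nonempty_iff_eq_empty] at hc
    simp [hc] at hp1
  obtain ⟨z₀, -, hz₀⟩ := Finset.exists_max_image Finset.univ F hne
  rcases le_or_gt (F z₀) 0 with h0 | h0
  · exact (Finset.sum_nonpos fun z _ => mul_nonpos_of_nonneg_of_nonpos (hp z)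
      ((hz₀ z (Finset.mem_univ z)).trans h0)).trans (Real.exp_pos _).le
  set m := Real.log (F z₀) with hm
  have hm_exp : Real.exp m = F z₀ := Real.exp_log h0
  have hma (w : A) : m ≤ k w + a w := by
    rw [hm, Real.log_le_iff_le_exp h0]
    refine (h w z₀).trans (Real.exp_le_exp.2 ?_)
    split_ifs <;> linarith [ha w]
  set s : A → ℝ := fun w => max (m - k w) 0 with hs
  have hs0 (w : A) : 0 ≤ s w := le_max_right _ _
  have hsk (w : A) : m - s w ≤ k w := by linarith [le_max_left (m - k w) 0]
  have hsa (w : A) : s w ≤ a w := max_le (by linarith [hma w]) (ha w)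
  have hF (z : A) : F z ≤ Real.exp m * (1 - s z + s z ^ 2 / 2) := by
    refine le_trans ?_ (mul_le_mul_of_nonneg_left (exp_neg_le_quadratic (hs0 z)) (Real.exp_pos m).le)
    rw [← Real.exp_add]
    rcases le_total (m - k z) 0 with hk | hk
    · simpa [hs, hk, hm_exp] using hz₀ z (Finset.mem_univ z)
    · simpa [hs, hk] using h z z
  calc ∑ z, p z * F z ≤ ∑ z, p z * (Real.exp m * (1 - s z + s z ^ 2 / 2)) :=
        Finset.sum_le_sum fun z _ => mul_le_mul_of_nonneg_left (hF z) (hp z)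
    _ = Real.exp m * (∑ z, p z * (-s z + s z ^ 2 / 2) + 1) := by
        have : ∑ z, p z * (1 - s z + s z ^ 2 / 2) =
            ∑ z, p z * (-s z + s z ^ 2 / 2) + ∑ z, p z := by
          rw [← Finset.sum_add_distrib]
          exact Finset.sum_congr rfl fun z _ => by ring
        rw [hp1] at this
        rw [← this, Finset.mul_sum]
        exact Finset.sum_congr rfl fun z _ => by ring
    _ ≤ Real.exp m * Real.exp (∑ z, p z * (-s z + s z ^ 2 / 2)) :=
        mul_le_mul_of_nonneg_left (Real.add_one_le_exp _) (Real.exp_pos m).le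
    _ = Real.exp (∑ z, p z * (m - s z + s z ^ 2 / 2)) := by
        rw [← Real.exp_add]
        congr 1
        have : m = ∑ z, p z * m := by rw [← Finset.sum_mul, hp1, one_mul]
        conv_lhs => rw [this]
        rw [← Finset.sum_add_distrib]
        exact Finset.sum_congr rfl fun z _ => by ring
    _ ≤ Real.exp (∑ w, p w * (k w + a w ^ 2 / 2)) := by
        refine Real.exp_le_exp.2 (Finset.sum_le_sum fun w _ => mul_le_mul_of_nonneg_left ?_ (hp w))
        have := pow_le_pow_left₀ (hs0 w) (hsa w) 2
        linarith [hsk w]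

/-- Weak transport inequality for product measures, in exponential form. -/
theorem prodExp_le_exp_of_le_exp {n : ℕ} {ν : Fin n → A → ℝ} (hν : ∀ j a, 0 ≤ ν j a)
    (hν1 : ∀ j, ∑ a, ν j a = 1) {F k : (Fin n → A) → ℝ} {α : Fin n → (Fin n → A) → ℝ}
    (hα : ∀ j x, 0 ≤ α j x)
    (h : ∀ x y, F y ≤ Real.exp (k x + ∑ j, if x j = y j then 0 else α j x)) :
    prodExp ν F ≤ Real.exp (prodExp ν fun x => k x + (∑ j, α j x ^ 2) / 2) := by
  induction n with
  | zero => simpa [prodExp_zero] using h default default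
  | succ n ih =>
    rw [prodExp_succ, prodExp_succ]
    refine (ih (fun j => hν j.succ) (fun j => hν1 j.succ)
      (k := fun x => ∑ w, ν 0 w * (k (Fin.cons w x) + α 0 (Fin.cons w x) ^ 2 / 2))
      (α := fun j x => ∑ w, ν 0 w * α j.succ (Fin.cons w x))
      (fun j x => Finset.sum_nonneg fun w _ => mul_nonneg (hν 0 w) (hα _ _))
      fun x y => ?_).trans (Real.exp_le_exp.2 (prodExp_mono (fun j => hν j.succ) fun x => ?_))
    · refine (sum_mul_le_exp_of_le_exp (hν 0) (hν1 0)
        (k := fun w => k (Fin.cons w x) + ∑ j, if x j = y j then 0 else α j.succ (Fin.cons w x))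
        (a := fun w => α 0 (Fin.cons w x)) (fun w => hα _ _) fun w z => ?_).trans_eq ?_
      · refine (h (Fin.cons w x) (Fin.cons z y)).trans_eq ?_
        simp only [Fin.sum_univ_succ, Fin.cons_zero, Fin.cons_succ]
        congr 1
        ring
      · congr 1
        have : (∑ j, if x j = y j then 0 else ∑ w, ν 0 w * α j.succ (Fin.cons w x)) =
            ∑ w, ν 0 w * ∑ j, if x j = y j then 0 else α j.succ (Fin.cons w x) := by
          simp only [Finset.mul_sum]
          rw [Finset.sum_comm]
          refine Finset.sum_congr rfl fun j _ => ?_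
          split_ifs <;> simp
        rw [this, ← Finset.sum_add_distrib]
        exact Finset.sum_congr rfl fun w _ => by ring
    · have jensen (j : Fin n) : (∑ w, ν 0 w * α j.succ (Fin.cons w x)) ^ 2 ≤
          ∑ w, ν 0 w * α j.succ (Fin.cons w x) ^ 2 :=
        Real.pow_arith_mean_le_arith_mean_pow Finset.univ (ν 0)
          (fun w => α j.succ (Fin.cons w x)) (fun w _ => hν 0 w) (hν1 0)
          (fun w _ => hα _ _) 2
      have := Finset.sum_le_sum fun j (_ : j ∈ Finset.univ) => jensen j
      rw [Finset.sum_comm] at this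
      simp only [Fin.sum_univ_succ, mul_add, add_div, Finset.sum_add_distrib, ← mul_div_assoc,
        Finset.mul_sum, ← Finset.sum_div] at this ⊢
      linarith

/-- Hoeffding's lemma for finitely supported weights. -/
theorem sum_mul_exp_le {p : A → ℝ} (hp : ∀ a, 0 ≤ p a) (hp1 : ∑ a, p a = 1)
    {f : A → ℝ} {c : ℝ} (h : ∀ w z, f w - f z ≤ c) :
    ∑ z, p z * Real.exp (f z) ≤ Real.exp (∑ w, p w * f w + c ^ 2 / 8) := by
  have hne : (Finset.univ : Finset A).Nonempty := by
    by_contra hc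
    rw [Finset.not_nonempty_iff_eq_empty] at hc
    simp [hc] at hp1
  obtain ⟨z₀, -, hz₀⟩ := Finset.exists_min_image Finset.univ f hne
  have hc : 0 ≤ c := by simpa using h z₀ z₀
  let _ : MeasurableSpace A := ⊤
  have : ∑ a, ENNReal.ofReal (p a) = 1 := by
    rw [← ENNReal.ofReal_sum_of_nonneg fun a _ => hp a, hp1, ENNReal.ofReal_one]
  set P : PMF A := PMF.ofFintype (fun a => ENNReal.ofReal (p a)) this with hP
  have hint (H : A → ℝ) : ∫ a, H a ∂P.toMeasure = ∑ a, p a * H a := by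
    rw [PMF.integral_eq_sum]
    refine Finset.sum_congr rfl fun a _ => ?_
    simp [hP, ENNReal.toReal_ofReal (hp a)]
  have key := (ProbabilityTheory.hasSubgaussianMGF_of_mem_Icc (μ := P.toMeasure) (X := f)
    (a := f z₀) (b := f z₀ + c) (measurable_of_finite f).aemeasurable
    (Filter.Eventually.of_forall fun w =>
      ⟨hz₀ w (Finset.mem_univ w), by linarith [h w z₀]⟩)).mgf_le 1
  rw [ProbabilityTheory.mgf, hint, hint] at key
  simp only [one_mul, add_sub_cancel_left, Real.exp_sub, NNReal.coe_pow, NNReal.coe_div,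
    coe_nnnorm, Real.norm_of_nonneg hc, NNReal.coe_ofNat, one_pow, mul_one] at key
  simp only [← mul_div_assoc, ← Finset.sum_div] at key
  rw [div_le_iff₀ (Real.exp_pos _), ← Real.exp_add] at key
  refine key.trans_eq ?_
  congr 1
  ring

/-- Exponential moment bound for functions with bounded differences. -/
theorem prodExp_exp_le_of_bounded_differences {n : ℕ} {ν : Fin n → A → ℝ}
    (hν : ∀ j a, 0 ≤ ν j a) (hν1 : ∀ j, ∑ a, ν j a = 1) {f : (Fin n → A) → ℝ} {c : Fin n → ℝ}
    (h : ∀ x y, f x - f y ≤ ∑ j, if x j = y j then 0 else c j) :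
    prodExp ν (fun x => Real.exp (f x)) ≤ Real.exp (prodExp ν f + (∑ j, c j ^ 2) / 8) := by
  induction n with
  | zero => simp [prodExp_zero]
  | succ n ih =>
    rw [prodExp_succ, prodExp_succ]
    have hoeffding (x : Fin n → A) : ∑ w, ν 0 w * Real.exp (f (Fin.cons w x)) ≤
        Real.exp (∑ w, ν 0 w * f (Fin.cons w x)) * Real.exp (c 0 ^ 2 / 8) := by
      rw [← Real.exp_add]
      by_cases hc : 0 ≤ c 0
      · refine sum_mul_exp_le (hν 0) (hν1 0) fun w z => (h _ _).trans ?_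
        simp only [Fin.sum_univ_succ, Fin.cons_zero, Fin.cons_succ]
        split_ifs <;> simp [hc]
      · have hconst (w z : A) : f (Fin.cons w x) - f (Fin.cons z x) ≤ 0 := by
          refine (h _ _).trans ?_
          simp only [Fin.sum_univ_succ, Fin.cons_zero, Fin.cons_succ]
          split_ifs <;> simp [(not_le.1 hc).le]
        refine (sum_mul_exp_le (hν 0) (hν1 0) hconst).trans (Real.exp_le_exp.2 ?_)
        nlinarith [sq_nonneg (c 0)]
    refine (prodExp_mono (fun j => hν j.succ) hoeffding).trans ?_
    rw [prodExp_mul_const]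
    refine (mul_le_mul_of_nonneg_right (ih (fun j => hν j.succ) (fun j => hν1 j.succ)
      (c := fun j => c j.succ) fun x y => ?_) (Real.exp_pos _).le).trans_eq ?_
    · rw [← Finset.sum_sub_distrib]
      calc ∑ w, (ν 0 w * f (Fin.cons w x) - ν 0 w * f (Fin.cons w y))
          ≤ ∑ w, ν 0 w * ∑ j : Fin n, if x j = y j then 0 else c j.succ := by
            refine Finset.sum_le_sum fun w _ => ?_
            rw [← mul_sub]
            refine mul_le_mul_of_nonneg_left ((h _ _).trans_eq ?_) (hν 0 w)
            simp [Fin.sum_univ_succ]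
        _ = _ := by rw [← Finset.sum_mul, hν1, one_mul]
    · rw [← Real.exp_add, Fin.sum_univ_succ]
      congr 1
      ring

/-- Chernoff's bound for a sub-Gaussian function on a product space. -/
theorem prodExp_tail_le {n : ℕ} {ν : Fin n → A → ℝ} (hν : ∀ j a, 0 ≤ ν j a)
    (hν1 : ∀ j, ∑ a, ν j a = 1) {f : (Fin n → A) → ℝ} {V u : ℝ} (hV : 0 ≤ V) (hu : 0 ≤ u)
    (h : ∀ s, 0 ≤ s → prodExp ν (fun x => Real.exp (s * f x)) ≤
      Real.exp (s * prodExp ν f + s ^ 2 * V / 2)) :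
    prodExp ν (fun x => if prodExp ν f + u ≤ f x then 1 else 0) ≤
      Real.exp (-u ^ 2 / (2 * V)) := by
  rcases hV.eq_or_lt with rfl | hV
  · simp only [mul_zero, div_zero, Real.exp_zero]
    refine (prodExp_mono hν fun x => ?_).trans_eq (prodExp_one hν1)
    split_ifs <;> norm_num
  set s := u / V with hs
  have hs0 : 0 ≤ s := by positivity
  calc prodExp ν (fun x => if prodExp ν f + u ≤ f x then 1 else 0)
      ≤ prodExp ν (fun x => Real.exp (s * f x) * Real.exp (-(s * (prodExp ν f + u)))) := by
        refine prodExp_mono hν fun x => ?_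
        rw [← Real.exp_add]
        split_ifs with hx
        · rw [Real.one_le_exp_iff]
          linarith [mul_le_mul_of_nonneg_left hx hs0]
        · positivity
    _ ≤ Real.exp (s * prodExp ν f + s ^ 2 * V / 2) * Real.exp (-(s * (prodExp ν f + u))) := by
        rw [prodExp_mul_const]
        exact mul_le_mul_of_nonneg_right (h s hs0) (Real.exp_pos _).le
    _ = Real.exp (-u ^ 2 / (2 * V)) := by
        rw [← Real.exp_add, hs]
        congr 1
        field_simp
        ring

end MomentBounds

section Hamming

variable {n : ℕ}

theorem dH_triangle (a b c : Equiv.Perm (Fin n)) : dH a c ≤ dH a b + dH b c := by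
  unfold dH
  norm_cast
  refine (Finset.card_le_card fun i => ?_).trans (Finset.card_union_le _ _)
  simp only [Finset.mem_filter_univ, Finset.mem_union]
  intro h
  by_contra! hc
  exact h (hc.1.trans hc.2)

theorem dH_self (a : Equiv.Perm (Fin n)) : dH a a = 0 := by simp [dH]

theorem dH_mul_left (a b c : Equiv.Perm (Fin n)) : dH (a * b) (a * c) = dH b c := by
  simp [dH]

theorem dH_mul_right (a b c : Equiv.Perm (Fin n)) : dH (a * c) (b * c) = dH a b := by
  unfold dH
  norm_cast
  refine Finset.card_equiv c fun i => ?_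
  rw [Finset.mem_filter_univ, Finset.mem_filter_univ]
  rfl

theorem dH_mul_le (a b a' b' : Equiv.Perm (Fin n)) :
    dH (a * b) (a' * b') ≤ dH a a' + dH b b' := by
  refine (dH_triangle _ (a' * b) _).trans_eq ?_
  rw [dH_mul_right, dH_mul_left]

theorem dH_list_prod_le {ι : Type*} (l : List ι) (a b : ι → Equiv.Perm (Fin n)) :
    dH (l.map a).prod (l.map b).prod ≤ (l.map fun j => dH (a j) (b j)).sum := by
  induction l with
  | nil => simp [dH_self]
  | cons j l ih =>
    simp only [List.map_cons, List.prod_cons, List.sum_cons]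
    exact (dH_mul_le _ _ _ _).trans (by linarith)

theorem dH_le_card (a b : Equiv.Perm (Fin n)) : dH a b ≤ n := by
  unfold dH
  exact_mod_cast (Finset.card_le_univ _).trans_eq (Fintype.card_fin n)

theorem dH_one_left (a : Equiv.Perm (Fin n)) : dH 1 a = degree a := by
  unfold dH degree
  congr 2
  ext i
  rw [Finset.mem_filter_univ, Finset.mem_filter_univ]
  exact ne_comm

theorem dH_one_right (a : Equiv.Perm (Fin n)) : dH a 1 = degree a := rfl

theorem dH_le_degree_add_degree_sub_one {a b : Equiv.Perm (Fin n)} {j : Fin n} (ha : a j ≠ j)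
    (hb : b j ≠ j) : dH a b ≤ (degree a : ℝ) + degree b - 1 := by
  unfold dH degree
  set A := Finset.univ.filter fun i => a i ≠ i with hA
  set B := Finset.univ.filter fun i => b i ≠ i with hB
  have hsub : (Finset.univ.filter fun i => a i ≠ b i) ⊆ A ∪ B := fun i => by
    simp only [hA, hB, Finset.mem_filter_univ, Finset.mem_union]
    intro h
    by_contra! hc
    exact h (hc.1.trans hc.2.symm)
  have hinter : 1 ≤ (A ∩ B).card := Finset.card_pos.2 ⟨j, by simp [hA, hB, ha, hb]⟩
  have hle := Finset.card_le_card hsub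
  have hcard := Finset.card_union_add_card_inter A B
  have : (Finset.univ.filter fun i => a i ≠ b i).card + 1 ≤ A.card + B.card := by omega
  have : (((Finset.univ.filter fun i => a i ≠ b i).card : ℝ)) + 1 ≤ A.card + B.card := by
    exact_mod_cast this
  linarith

end Hamming

section LocalBase

variable {n ℓ : ℕ} {G : Subgroup (Equiv.Perm (Fin n))} {t : Fin n → Fin n → Equiv.Perm (Fin n)}

/-- The family `t`, replaced by the identity at all irrelevant indices. -/
def trivialExtension (G : Subgroup (Equiv.Perm (Fin n)))
    (t : Fin n → Fin n → Equiv.Perm (Fin n)) (i j : Fin n) : Equiv.Perm (Fin n) :=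
  if (j : ℕ) ≠ 0 ∧ i ∈ Orb G j ∧ i ≠ j then t i j else 1

theorem mem_drop_one_finRange_iff {j : Fin n} :
    j ∈ (List.finRange n).drop 1 ↔ (j : ℕ) ≠ 0 := by
  cases n with
  | zero => exact j.elim0
  | succ n =>
    rw [List.finRange_succ]
    cases j using Fin.cases <;> simp

theorem IsLocalBase.trivialExtension_eq (ht : IsLocalBase ℓ G t) {i j : Fin n}
    (hj : (j : ℕ) ≠ 0) (hi : i ∈ Orb G j) : trivialExtension G t i j = t i j := by
  unfold trivialExtension
  by_cases hij : i = j
  · subst hij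
    simp [(ht i hj).1]
  · simp [hj, hi, hij]

theorem IsLocalBase.trivialExtension_mem (ht : IsLocalBase ℓ G t) (i j : Fin n) :
    trivialExtension G t i j ∈ G := by
  unfold trivialExtension
  split_ifs with h
  · exact ((ht j h.1).2 i h.2.1 h.2.2).1.1
  · exact G.one_mem

theorem IsLocalBase.UT_trivialExtension_mem (ht : IsLocalBase ℓ G t) (x : Fin n → Fin n) :
    UT (trivialExtension G t) x ∈ G := by
  refine G.list_prod_mem fun σ hσ => ?_
  obtain ⟨j, -, rfl⟩ := List.mem_map.1 hσ
  exact ht.trivialExtension_mem _ _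

theorem IsLocalBase.UT_trivialExtension (ht : IsLocalBase ℓ G t) {x : Fin n → Fin n}
    (hx : ∀ j, x j ∈ Orb G j) : UT (trivialExtension G t) x = UT t x := by
  unfold UT
  congr 1
  exact List.map_congr_left fun j hj =>
    ht.trivialExtension_eq (mem_drop_one_finRange_iff.1 hj) (hx j)

theorem IsLocalBase.trivialExtension_eq_one_or (ht : IsLocalBase ℓ G t) (i j : Fin n) :
    trivialExtension G t i j = 1 ∨
      (trivialExtension G t i j j ≠ j ∧ degree (trivialExtension G t i j) ≤ ℓ) := by
  unfold trivialExtension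
  split_ifs with h
  · obtain ⟨-, hij, hdeg⟩ := (ht j h.1).2 i h.2.1 h.2.2
    exact Or.inr ⟨fun hjj => h.2.2 ((t i j).injective (hij.trans hjj.symm)), hdeg⟩
  · exact Or.inl rfl

theorem IsLocalBase.dH_trivialExtension_le (hℓ : 1 ≤ ℓ) (ht : IsLocalBase ℓ G t)
    (i i' j : Fin n) :
    dH (trivialExtension G t i j) (trivialExtension G t i' j) ≤
      min (2 * (ℓ : ℝ) - 1) (n : ℝ) := by
  refine le_min ?_ (dH_le_card _ _)
  have hℓ' : (1 : ℝ) ≤ ℓ := by exact_mod_cast hℓ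
  rcases ht.trivialExtension_eq_one_or i j with h | ⟨h, hd⟩ <;>
    rcases ht.trivialExtension_eq_one_or i' j with h' | ⟨h', hd'⟩
  · rw [h, h', dH_self]
    linarith
  · rw [h, dH_one_left]
    have : (degree (trivialExtension G t i' j) : ℝ) ≤ ℓ := by exact_mod_cast hd'
    linarith
  · rw [h', dH_one_right]
    have : (degree (trivialExtension G t i j) : ℝ) ≤ ℓ := by exact_mod_cast hd
    linarith
  · have h1 : (degree (trivialExtension G t i' j) : ℝ) ≤ ℓ := by exact_mod_cast hd'
    have h2 : (degree (trivialExtension G t i j) : ℝ) ≤ ℓ := by exact_mod_cast hd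
    linarith [dH_le_degree_add_degree_sub_one h h']

theorem IsLocalBase.dH_UT_le (hℓ : 1 ≤ ℓ) (ht : IsLocalBase ℓ G t) (x y : Fin n → Fin n) :
    dH (UT (trivialExtension G t) x) (UT (trivialExtension G t) y) ≤
      ∑ j, if x j = y j then 0 else
        if (j : ℕ) ≠ 0 ∧ Orb G j ≠ {j} then min (2 * (ℓ : ℝ) - 1) (n : ℝ) else 0 := by
  have hc : 0 ≤ min (2 * (ℓ : ℝ) - 1) (n : ℝ) := by
    have : (1 : ℝ) ≤ ℓ := by exact_mod_cast hℓ
    exact le_min (by linarith) (Nat.cast_nonneg n)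
  refine (dH_list_prod_le _ _ _).trans ?_
  rw [← List.sum_toFinset _ ((List.nodup_finRange n).sublist (List.drop_sublist 1 _))]
  refine (Finset.sum_le_sum fun j hj => ?_).trans
    (Finset.sum_le_sum_of_subset_of_nonneg (Finset.subset_univ _) fun j _ _ => by
      split_ifs <;> simp [hc])
  have hj0 : (j : ℕ) ≠ 0 := mem_drop_one_finRange_iff.1 (List.mem_toFinset.1 hj)
  split_ifs with hxy horb
  · rw [hxy, dH_self]
  · exact ht.dH_trivialExtension_le hℓ _ _ _
  · have horb : Orb G j = {j} := by
      by_contra hne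
      exact horb ⟨hj0, hne⟩
    have h1 (i : Fin n) : trivialExtension G t i j = 1 := by
      simp [trivialExtension, horb]
    rw [h1, h1, dH_self]

theorem sum_mul_eq_prodExp (ht : IsLocalBase ℓ G t) {μ : Equiv.Perm (Fin n) → ℝ}
    {ν : Fin n → Fin n → ℝ} (hν : ∀ j i, i ∉ Orb G j → ν j i = 0)
    (hμ : ∀ σ, μ σ = ∑ i : Fin n → Fin n, if UT t i = σ then ∏ j, ν j (i j) else 0)
    (φ : Equiv.Perm (Fin n) → ℝ) :
    ∑ σ, φ σ * μ σ = prodExp ν fun x => φ (UT (trivialExtension G t) x) := by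
  have : prodExp ν (fun x => φ (UT (trivialExtension G t) x)) =
      prodExp ν fun x => φ (UT t x) := by
    refine prodExp_congr fun x hx => ?_
    rw [ht.UT_trivialExtension fun j => ?_]
    by_contra hj
    exact hx (Finset.prod_eq_zero (Finset.mem_univ j) (hν j _ hj))
  rw [this]
  simp only [hμ, Finset.mul_sum]
  rw [Finset.sum_comm]
  refine Finset.sum_congr rfl fun x _ => ?_
  simp [mul_comm]

theorem sum_sq_eq_Kn_mul (G : Subgroup (Equiv.Perm (Fin n))) (b : ℝ) :
    ∑ j : Fin n, (if (j : ℕ) ≠ 0 ∧ Orb G j ≠ {j} then b else 0) ^ 2 = (Kn G : ℝ) * b ^ 2 := by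
  simp [Kn, ite_pow, Finset.sum_ite]

end LocalBase

section Deviation

variable {n ℓ : ℕ} {G : Subgroup (Equiv.Perm (Fin n))} {t : Fin n → Fin n → Equiv.Perm (Fin n)}
  {ν : Fin n → Fin n → ℝ}

/-- Upper deviation inequality on the product space for functions Lipschitz in Hamming distance. -/
theorem prodExp_tail_le_of_lipschitz (hℓ : 1 ≤ ℓ) (ht : IsLocalBase ℓ G t)
    (hν : ∀ j i, 0 ≤ ν j i) (hν1 : ∀ j, ∑ i, ν j i = 1) {g : Equiv.Perm (Fin n) → ℝ} {S u : ℝ}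
    (hS : 0 ≤ S) (hu : 0 ≤ u)
    (hg : ∀ σ ∈ G, ∀ τ ∈ G, g τ - g σ ≤ √S * dH τ σ) :
    prodExp ν (fun x => if prodExp ν (fun x => g (UT (trivialExtension G t) x)) + u ≤
        g (UT (trivialExtension G t) x) then 1 else 0) ≤
      Real.exp (-(2 * u ^ 2) /
        ((Kn G : ℝ) * (min (2 * (ℓ : ℝ) - 1) (n : ℝ)) ^ 2 * S)) := by
  set c := min (2 * (ℓ : ℝ) - 1) (n : ℝ) with hc
  refine (prodExp_tail_le (V := (Kn G : ℝ) * c ^ 2 * S / 4) hν hν1 (by positivity) hu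
    fun s hs => ?_).trans_eq ?_
  · refine (prodExp_exp_le_of_bounded_differences hν hν1
      (c := fun j : Fin n => if (j : ℕ) ≠ 0 ∧ Orb G j ≠ {j} then s * √S * c else 0)
      fun x y => ?_).trans_eq ?_
    · rw [← mul_sub]
      calc s * (g (UT (trivialExtension G t) x) - g (UT (trivialExtension G t) y))
          ≤ s * (√S * ∑ j, if x j = y j then 0 else
              if (j : ℕ) ≠ 0 ∧ Orb G j ≠ {j} then c else 0) := by
            refine mul_le_mul_of_nonneg_left ((hg _ (ht.UT_trivialExtension_mem y) _
              (ht.UT_trivialExtension_mem x)).trans ?_) hs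
            exact mul_le_mul_of_nonneg_left (ht.dH_UT_le hℓ x y) (Real.sqrt_nonneg S)
        _ = _ := by
            rw [← mul_assoc, Finset.mul_sum]
            refine Finset.sum_congr rfl fun j _ => ?_
            split_ifs <;> simp
    · rw [sum_sq_eq_Kn_mul, prodExp_const_mul, mul_pow, mul_pow, Real.sq_sqrt hS]
      congr 1
      ring
  · congr 1
    rw [show 2 * ((Kn G : ℝ) * c ^ 2 * S / 4) = (Kn G : ℝ) * c ^ 2 * S / 2 by ring,
      div_div_eq_mul_div]
    congr 1
    ring

/-- Lower deviation inequality on the product space, with the mean of the squared local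
Lipschitz constants as variance factor. -/
theorem prodExp_lower_tail_le (hℓ : 1 ≤ ℓ) (ht : IsLocalBase ℓ G t)
    (hν : ∀ j i, 0 ≤ ν j i) (hν1 : ∀ j, ∑ i, ν j i = 1) {g β : Equiv.Perm (Fin n) → ℝ} {u : ℝ}
    (hβ : ∀ σ ∈ G, 0 ≤ β σ) (hu : 0 ≤ u)
    (hg : ∀ σ ∈ G, ∀ τ ∈ G, g τ - g σ ≤ β τ * dH τ σ) :
    prodExp ν (fun x => if prodExp ν (fun x => -g (UT (trivialExtension G t) x)) + u ≤
        -g (UT (trivialExtension G t) x) then 1 else 0) ≤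
      Real.exp (-(2 * u ^ 2) /
        ((Kn G : ℝ) * (min (2 * (ℓ : ℝ) - 1) (n : ℝ)) ^ 2 *
          (4 * prodExp ν fun x => β (UT (trivialExtension G t) x) ^ 2))) := by
  set c := min (2 * (ℓ : ℝ) - 1) (n : ℝ) with hc
  have hc0 : 0 ≤ c := by
    have : (1 : ℝ) ≤ ℓ := by exact_mod_cast hℓ
    exact le_min (by linarith) (Nat.cast_nonneg n)
  set E := prodExp ν fun x => β (UT (trivialExtension G t) x) ^ 2 with hE
  have hE0 : 0 ≤ E := prodExp_nonneg hν fun x => sq_nonneg _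
  refine (prodExp_tail_le (V := (Kn G : ℝ) * c ^ 2 * E) hν hν1 (by positivity) hu
    fun s hs => ?_).trans_eq ?_
  · have hβx (x : Fin n → Fin n) : 0 ≤ β (UT (trivialExtension G t) x) :=
      hβ _ (ht.UT_trivialExtension_mem x)
    refine (prodExp_le_exp_of_le_exp hν hν1
      (k := fun x => s * -g (UT (trivialExtension G t) x))
      (α := fun (j : Fin n) x => if (j : ℕ) ≠ 0 ∧ Orb G j ≠ {j} then
        s * β (UT (trivialExtension G t) x) * c else 0)
      (fun j x => ?_) fun x y => Real.exp_le_exp.2 ?_).trans_eq ?_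
    · split_ifs
      · exact mul_nonneg (mul_nonneg hs (hβx x)) hc0
      · exact le_rfl
    · have key : s * (g (UT (trivialExtension G t) x) - g (UT (trivialExtension G t) y)) ≤
          s * (β (UT (trivialExtension G t) x) * ∑ j, if x j = y j then 0 else
              if (j : ℕ) ≠ 0 ∧ Orb G j ≠ {j} then c else 0) := by
        refine mul_le_mul_of_nonneg_left ((hg _ (ht.UT_trivialExtension_mem y) _
          (ht.UT_trivialExtension_mem x)).trans ?_) hs
        exact mul_le_mul_of_nonneg_left (ht.dH_UT_le hℓ x y) (hβx x)
      rw [← mul_assoc, Finset.mul_sum] at key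
      refine le_trans (by linarith) (add_le_add_right (key.trans_eq ?_) _)
      refine Finset.sum_congr rfl fun j _ => ?_
      split_ifs <;> simp
    · rw [prodExp_add, prodExp_const_mul]
      simp only [sum_sq_eq_Kn_mul]
      have : (fun x => (Kn G : ℝ) * (s * β (UT (trivialExtension G t) x) * c) ^ 2 / 2) =
          fun x => ((Kn G : ℝ) * s ^ 2 * c ^ 2 / 2) * β (UT (trivialExtension G t) x) ^ 2 := by
        funext x
        ring
      rw [this, prodExp_const_mul, ← hE]
      congr 1
      ring
  · congr 1
    rw [show (Kn G : ℝ) * c ^ 2 * (4 * E) = 2 * (2 * ((Kn G : ℝ) * c ^ 2 * E)) by ring,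
      ← mul_neg, mul_div_mul_left _ _ two_ne_zero]

end Deviation

/-- Deviation inequalities for functions with a Lipschitz-type bound, for measures
of the class `M_T`, with `c = min(2ℓ-1, n)`. -/
theorem stmt13 {n ℓ : ℕ} (hn : 2 ≤ n) (hℓ : 2 ≤ ℓ) (hℓn : ℓ ≤ n)
    (G : Subgroup (Equiv.Perm (Fin n))) (hG : G ≠ ⊥)
    (t : Fin n → Fin n → Equiv.Perm (Fin n)) (ht : IsLocalBase ℓ G t)
    (μ : Equiv.Perm (Fin n) → ℝ) (hμ : MemMT G t μ)
    (g β : Equiv.Perm (Fin n) → ℝ) (hβ : ∀ σ ∈ G, 0 ≤ β σ)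
    (hgβ : ∀ σ ∈ G, ∀ τ ∈ G, g τ - g σ ≤ β τ * dH τ σ)
    (u : ℝ) (hu : 0 ≤ u) :
    (∑ σ ∈ Finset.univ.filter
        (fun σ : Equiv.Perm (Fin n) => (∑ τ, g τ * μ τ) + u ≤ g σ), μ σ) ≤
      Real.exp (-(2 * u ^ 2) /
        ((Kn G : ℝ) * (min (2 * (ℓ : ℝ) - 1) (n : ℝ)) ^ 2 *
          (⨆ σ : G, β (σ : Equiv.Perm (Fin n)) ^ 2))) ∧
    (∑ σ ∈ Finset.univ.filter
        (fun σ : Equiv.Perm (Fin n) => g σ ≤ (∑ τ, g τ * μ τ) - u), μ σ) ≤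
      Real.exp (-(2 * u ^ 2) /
        ((Kn G : ℝ) * (min (2 * (ℓ : ℝ) - 1) (n : ℝ)) ^ 2 *
          min (⨆ σ : G, β (σ : Equiv.Perm (Fin n)) ^ 2) (4 * ∑ σ, β σ ^ 2 * μ σ))) := by
  obtain ⟨ν, hνp, hμν⟩ := hμ
  have hν0 (j i) : 0 ≤ ν j i := (hνp j).1 i
  have hν1 (j) : ∑ i, ν j i = 1 := (hνp j).2.2
  have hℓ1 : 1 ≤ ℓ := by omega
  have transfer := sum_mul_eq_prodExp ht (fun j i => (hνp j).2.1 i) hμν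
  have tail (p : Equiv.Perm (Fin n) → Prop) : ∑ σ ∈ Finset.univ.filter p, μ σ =
      prodExp ν fun x => if p (UT (trivialExtension G t) x) then 1 else 0 := by
    rw [← transfer fun σ => if p σ then 1 else 0, Finset.sum_filter]
    simp
  set S := ⨆ σ : G, β (σ : Equiv.Perm (Fin n)) ^ 2 with hS
  have hS0 : 0 ≤ S := Real.iSup_nonneg fun σ => sq_nonneg _
  have hβS {σ} (hσ : σ ∈ G) : β σ ≤ √S :=
    Real.le_sqrt_of_sq_le (le_ciSup (f := fun σ : G => β (σ : Equiv.Perm (Fin n)) ^ 2)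
      (Set.finite_range _).bddAbove ⟨σ, hσ⟩)
  have hd (σ τ : Equiv.Perm (Fin n)) : 0 ≤ dH σ τ := Nat.cast_nonneg _
  have hlower (x : Fin n → Fin n) : g (UT (trivialExtension G t) x) ≤ (∑ τ, g τ * μ τ) - u ↔
      prodExp ν (fun x => -g (UT (trivialExtension G t) x)) + u ≤
        -g (UT (trivialExtension G t) x) := by
    rw [prodExp_neg, transfer]
    constructor <;> intro h <;> linarith
  refine ⟨?_, ?_⟩
  · rw [tail, transfer]
    exact prodExp_tail_le_of_lipschitz hℓ1 ht hν0 hν1 hS0 hu fun σ hσ τ hτ =>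
      (hgβ σ hσ τ hτ).trans (mul_le_mul_of_nonneg_right (hβS hτ) (hd _ _))
  · rw [tail]
    simp only [hlower]
    rcases min_choice S (4 * ∑ σ, β σ ^ 2 * μ σ) with h | h
    · rw [h]
      refine prodExp_tail_le_of_lipschitz (g := fun σ => -g σ) hℓ1 ht hν0 hν1 hS0 hu
        fun σ hσ τ hτ => ?_
      have := (hgβ τ hτ σ hσ).trans (mul_le_mul_of_nonneg_right (hβS hσ) (hd _ _))
      have hcomm : dH σ τ = dH τ σ := by simp [dH, ne_comm]
      rw [← hcomm]
      linarith
    · rw [h, transfer fun σ => β σ ^ 2]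
      exact prodExp_lower_tail_le hℓ1 ht hν0 hν1 hβ hu hgβ

end
end
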